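/- Let G be a finite simple graph that contains no induced subgraph isomorphic to the Chair (the 5-vertex tree obtained from a path on four vertices by adding a pendant vertex adjacent to the second vertex of the path, equivalently K1,3 with one edge subdivided) and no induced subgraph isomorphic to the Kite (the 5-vertex graph obtained from the diamond K4 minus an edge by adding a pendant vertex adjacent to one of the two degree-2 vertices of the diamond). Then χ(G) ≤ ⌈(Δ(G) + ω(G) + 1)/2⌉. -/

import Mathlib

open SimpleGraph

/-- The Chair: the path `0-1-2-3` together with a pendant vertex `4` adjacent to the
second vertex `1` of the path (equivalently, `K_{1,3}` with one edge subdivided). -/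
def chair : SimpleGraph (Fin 5) :=
  SimpleGraph.fromRel (fun a b =>
    (a = 0 ∧ b = 1) ∨ (a = 1 ∧ b = 2) ∨ (a = 2 ∧ b = 3) ∨ (a = 1 ∧ b = 4))

/-- The Kite: the diamond (`K4` minus the edge `23`) on `{0,1,2,3}` together with a
pendant vertex `4` adjacent to the degree-2 vertex `2`. -/
def kite : SimpleGraph (Fin 5) :=
  SimpleGraph.fromRel (fun a b =>
    (a = 0 ∧ b = 1) ∨ (a = 0 ∧ b = 2) ∨ (a = 0 ∧ b = 3) ∨
    (a = 1 ∧ b = 2) ∨ (a = 1 ∧ b = 3) ∨ (a = 2 ∧ b = 4))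

section
open scoped Classical
variable {V : Type*}

/-- `G` restricted to `s` has a proper colouring with colours below `k`. -/
def ColorableOn (G : SimpleGraph V) (s : Finset V) (k : ℕ) : Prop :=
  ∃ c : V → ℕ, (∀ x ∈ s, c x < k) ∧ ∀ x ∈ s, ∀ y ∈ s, G.Adj x y → c x ≠ c y

theorem colorableOn_of_card_image_le {α : Type*} [DecidableEq α] {G : SimpleGraph V} {s : Finset V}
    {k : ℕ} (c : V → α) (hc : ∀ x ∈ s, ∀ y ∈ s, G.Adj x y → c x ≠ c y)
    (hk : (s.image c).card ≤ k) : ColorableOn G s k := by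
  have key : ∀ x ∈ s, c x ∈ s.image c := fun x hx => Finset.mem_image_of_mem c hx
  refine ⟨fun x => if h : c x ∈ s.image c then ((s.image c).equivFin ⟨c x, h⟩ : ℕ) else 0, ?_, ?_⟩
  · intro x hx
    simp only [key x hx, dite_true]
    exact (Fin.isLt _).trans_le hk
  · intro x hx y hy hxy h
    simp only [key x hx, key y hy, dite_true] at h
    have := (s.image c).equivFin.injective (Fin.ext h)
    exact hc x hx y hy hxy (congrArg Subtype.val this)

theorem ColorableOn.union {G : SimpleGraph V} {s t : Finset V} {a b : ℕ}
    (hs : ColorableOn G s a) (ht : ColorableOn G t b) : ColorableOn G (s ∪ t) (a + b) := by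
  obtain ⟨c, hc1, hc2⟩ := hs
  obtain ⟨e, he1, he2⟩ := ht
  refine ⟨fun x => if x ∈ s then c x else a + e x, ?_, ?_⟩
  · intro x hx
    by_cases hxs : x ∈ s
    · have := hc1 x hxs
      simp only [hxs, if_true]
      omega
    · have := he1 x (by simpa [hxs] using hx)
      simp only [hxs, if_false]
      omega
  · intro x hx y hy hxy
    by_cases hxs : x ∈ s <;> by_cases hys : y ∈ s <;> simp only [hxs, hys, if_true, if_false]
    · exact hc2 x hxs y hys hxy
    · have := hc1 x hxs
      omega
    · have := hc1 y hys
      omega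
    · have := he2 x (by simpa [hxs] using hx) y (by simpa [hys] using hy) hxy
      omega

theorem ColorableOn.mono {G : SimpleGraph V} {s : Finset V} {a b : ℕ}
    (hs : ColorableOn G s a) (hab : a ≤ b) : ColorableOn G s b := by
  obtain ⟨c, hc1, hc2⟩ := hs
  exact ⟨c, fun x hx => (hc1 x hx).trans_le hab, hc2⟩

/-- The neighbourhood of `x` as a finset. -/
noncomputable def nbrs [Fintype V] (G : SimpleGraph V) (x : V) : Finset V :=
  Finset.univ.filter fun y => G.Adj x y

@[simp]
theorem mem_nbrs [Fintype V] {G : SimpleGraph V} {x y : V} : y ∈ nbrs G x ↔ G.Adj x y := by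
  simp [nbrs]

/-- If some `k`-colouring of `t` leaves at most as many colours on `s` as remain after an optimal
colouring of a part complete to `s`, then `s` can be coloured with the remaining colours. -/
theorem colorableOn_of_complete {G : SimpleGraph V} {s t : Finset V} {k m : ℕ} {c : V → ℕ}
    (hck : ∀ x ∈ s ∪ t, c x < k) (hc : ∀ x ∈ s ∪ t, ∀ y ∈ s ∪ t, G.Adj x y → c x ≠ c y)
    (hst : ∀ x ∈ s, ∀ y ∈ t, G.Adj x y) (hm : k ≤ (t.image c).card + m) :
    ColorableOn G s m := by
  refine colorableOn_of_card_image_le c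
    (fun x hx y hy => hc x (Finset.mem_union_left _ hx) y (Finset.mem_union_left _ hy)) ?_
  have hd : Disjoint (s.image c) (t.image c) := by
    rw [Finset.disjoint_left]
    rintro i hi hj
    obtain ⟨x, hx, rfl⟩ := Finset.mem_image.1 hi
    obtain ⟨y, hy, hxy⟩ := Finset.mem_image.1 hj
    exact hc x (Finset.mem_union_left _ hx) y (Finset.mem_union_right _ hy) (hst x hx y hy) hxy.symm
  have hsub : s.image c ∪ t.image c ⊆ Finset.range k := by
    rw [← Finset.image_union]
    intro i hi
    obtain ⟨x, hx, rfl⟩ := Finset.mem_image.1 hi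
    exact Finset.mem_range.2 (hck x hx)
  have := Finset.card_le_card hsub
  rw [Finset.card_union_of_disjoint hd, Finset.card_range] at this
  omega

/-- In a finite graph the degree sum over the component of `t` is at least that of a tree. -/
theorem two_mul_card_reachable_le [Fintype V] {G : SimpleGraph V} {t : V} {s : Finset V}
    (hs : ∀ x, x ∈ s ↔ G.Reachable t x) :
    2 * s.card ≤ ∑ x ∈ s, (nbrs G x).card + 2 := by
  set C := G.connectedComponentMk t with hC
  have hmem : ∀ x, x ∈ C.supp ↔ G.Reachable t x := fun x => by
    rw [ConnectedComponent.mem_supp_iff, hC, ConnectedComponent.eq]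
    exact ⟨fun h => h.symm, fun h => h.symm⟩
  have hconn : C.toSimpleGraph.Connected := C.connected_toSimpleGraph
  have h1 := hconn.card_vert_le_card_edgeSet_add_one
  have h2 := C.toSimpleGraph.sum_degrees_eq_twice_card_edges
  have h3 : Nat.card C.toSimpleGraph.edgeSet = C.toSimpleGraph.edgeFinset.card := by
    rw [Nat.card_eq_fintype_card, edgeFinset_card]
  have h4 : Nat.card C = s.card := by
    rw [Nat.card_eq_fintype_card]
    exact Fintype.card_of_subtype (p := fun x => x ∈ C) _ fun x => (hs x).trans (hmem x).symm
  have h5 : ∑ x ∈ s, (nbrs G x).card = ∑ v, C.toSimpleGraph.degree v := by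
    rw [Finset.sum_subtype s (p := fun x => x ∈ C)
      (fun x => (hs x).trans (hmem x).symm)]
    refine Finset.sum_congr rfl fun v _ => ?_
    rw [← card_neighborFinset_eq_degree]
    symm
    refine Finset.card_bij (fun u _ => u.1) ?_ ?_ ?_
    · intro u hu
      have : C.toSimpleGraph.Adj v u := by simpa using hu
      exact mem_nbrs.2 this
    · intro a _ b _ h
      exact Subtype.ext h
    · intro b hb
      have hb' : G.Adj v.1 b := by simpa using hb
      have : b ∈ C.supp := (hmem b).2 (((hmem v.1).1 v.2).trans hb'.reachable)
      exact ⟨⟨b, this⟩, (mem_neighborFinset _ _ _).2 hb', rfl⟩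
  omega
end

section
open scoped Classical
variable {V : Type*}

/-- Pointwise form of having no induced chair. -/
def ChairFree (G : SimpleGraph V) : Prop :=
  ∀ c a b x y, G.Adj c a → G.Adj c b → G.Adj c x → G.Adj x y → a ≠ b → ¬G.Adj a b → ¬G.Adj a x →
    ¬G.Adj b x → ¬G.Adj c y → ¬G.Adj a y → ¬G.Adj b y → False

/-- Pointwise form of having no induced kite. -/
def KiteFree (G : SimpleGraph V) : Prop :=
  ∀ p q a b z, G.Adj p q → G.Adj p a → G.Adj p b → G.Adj q a → G.Adj q b → G.Adj a z →
    ¬G.Adj a b → ¬G.Adj z p → ¬G.Adj z q → ¬G.Adj z b → False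

/-- `s` is a set of pairwise adjacent vertices. -/
def CliqueOn (G : SimpleGraph V) (s : Finset V) : Prop :=
  ∀ x ∈ s, ∀ y ∈ s, x ≠ y → G.Adj x y

/-- `G` is a chair- and kite-free graph of maximum degree at most `d` and clique number at most `w`
that is not `⌈(d + w + 1) / 2⌉`-colourable, while the bound holds on all proper subsets. -/
structure MinCounterexample [Fintype V] (G : SimpleGraph V) (d w k : ℕ) : Prop where
  chairFree : ChairFree G
  kiteFree : KiteFree G
  card_nbrs_le : ∀ x, (nbrs G x).card ≤ d
  card_clique_le : ∀ s, CliqueOn G s → s.card ≤ w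
  bound_eq : k = (d + w + 2) / 2
  not_colorableOn : ¬ColorableOn G Finset.univ k
  colorableOn_of_ne : ∀ s : Finset V, s ≠ Finset.univ → ∀ d' w',
    (∀ x ∈ s, (nbrs G x ∩ s).card ≤ d') → (∀ t ⊆ s, CliqueOn G t → t.card ≤ w') →
    ColorableOn G s ((d' + w' + 2) / 2)

theorem exists_adj_of_not_colorableOn [Fintype V] {G : SimpleGraph V} {k : ℕ}
    (hn : ¬ColorableOn G Finset.univ k) {v : V} {c : V → ℕ} (hk : ∀ x, x ≠ v → c x < k)
    (hc : ∀ x, x ≠ v → ∀ y, y ≠ v → G.Adj x y → c x ≠ c y) {i : ℕ} (hi : i < k) :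
    ∃ u, G.Adj v u ∧ c u = i := by
  by_contra! hcon
  refine hn ⟨fun x => if x = v then i else c x, fun x _ => ?_, fun x _ y _ hxy => ?_⟩
  · by_cases h : x = v
    · simpa [h] using hi
    · simpa [h] using hk x h
  · by_cases h : x = v <;> by_cases h' : y = v <;> simp only [h, h', if_true, if_false]
    · exact absurd hxy (by simp [h, h'])
    · exact (hcon y (h ▸ hxy)).symm
    · exact hcon x (h' ▸ hxy.symm)
    · exact hc x h y h' hxy

namespace MinCounterexample
variable [Fintype V] {G : SimpleGraph V} {d w k : ℕ}

theorem crit (h : MinCounterexample G d w k) {s : Finset V} (hs : s ≠ Finset.univ) :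
    ColorableOn G s k := by
  rw [h.bound_eq]
  exact h.colorableOn_of_ne s hs d w
    (fun x _ => (Finset.card_le_card Finset.inter_subset_left).trans (h.card_nbrs_le x))
    fun t _ ht => h.card_clique_le t ht

theorem exists_coloring (h : MinCounterexample G d w k) (v : V) :
    ∃ c : V → ℕ, (∀ x, x ≠ v → c x < k) ∧
      (∀ x, x ≠ v → ∀ y, y ≠ v → G.Adj x y → c x ≠ c y) := by
  obtain ⟨c, h1, h2⟩ := h.crit (s := Finset.univ.erase v) (by simp [Finset.erase_eq_self])
  exact ⟨c, fun x hx => h1 x (by simp [hx]), fun x hx y hy => h2 x (by simp [hx]) y (by simp [hy])⟩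

theorem le_card_nbrs (h : MinCounterexample G d w k) (v : V) : k ≤ (nbrs G v).card := by
  obtain ⟨c, h1, h2⟩ := h.exists_coloring v
  have : Finset.range k ⊆ (nbrs G v).image c := fun i hi => by
    obtain ⟨u, hu, rfl⟩ := exists_adj_of_not_colorableOn h.not_colorableOn h1 h2
      (Finset.mem_range.1 hi)
    exact Finset.mem_image_of_mem c (mem_nbrs.2 hu)
  simpa using (Finset.card_le_card this).trans Finset.card_image_le

theorem exists_adj_compl (h : MinCounterexample G d w k) {s : Finset V} (hs : s.Nonempty)
    (hs' : s ≠ Finset.univ) : ∃ x ∈ s, ∃ y, y ∉ s ∧ G.Adj x y := by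
  by_contra! hcon
  obtain ⟨c, h1, h2⟩ := h.crit hs'
  obtain ⟨e, h3, h4⟩ := h.crit (s := sᶜ) (by
    obtain ⟨x, hx⟩ := hs
    intro h'
    have := Finset.mem_univ x
    rw [← h'] at this
    simp [hx] at this)
  refine h.not_colorableOn ⟨fun x => if x ∈ s then c x else e x, fun x _ => ?_,
    fun x _ y _ hxy => ?_⟩
  · by_cases hx : x ∈ s
    · simpa [hx] using h1 x hx
    · simpa [hx] using h3 x (by simpa using hx)
  · by_cases hx : x ∈ s <;> by_cases hy : y ∈ s <;> simp only [hx, hy, if_true, if_false]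
    · exact h2 x hx y hy hxy
    · exact absurd hxy (hcon x hx y hy)
    · exact absurd hxy.symm (hcon y hy x hx)
    · exact h4 x (by simpa using hx) y (by simpa using hy) hxy

theorem nonempty (h : MinCounterexample G d w k) : Nonempty V := by
  by_contra hV
  rw [not_nonempty_iff] at hV
  exact h.not_colorableOn ⟨fun _ => 0, fun x => hV.elim x, fun x => hV.elim x⟩

theorem not_simplicial (h : MinCounterexample G d w k) (v : V)
    (hv : CliqueOn G (nbrs G v)) : False := by
  have h1 := h.le_card_nbrs v
  have h2 := h.card_nbrs_le v
  have h3 := h.card_clique_le (insert v (nbrs G v)) (by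
    intro x hx y hy hxy
    simp only [Finset.mem_insert, mem_nbrs] at hx hy
    rcases hx with rfl | hx <;> rcases hy with rfl | hy
    · exact absurd rfl hxy
    · exact hy
    · exact hx.symm
    · exact hv x (mem_nbrs.2 hx) y (mem_nbrs.2 hy) hxy)
  rw [Finset.card_insert_of_notMem (by simp)] at h3
  have := h.bound_eq
  omega

/-- Removing a `j`-colourable set in which every outer vertex has `2 * j` neighbours. -/
theorem reduce (h : MinCounterexample G d w k) {s : Finset V} (hs : s.Nonempty) {j : ℕ}
    (hj : j ≤ k) (hsj : ColorableOn G s j)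
    (hd : ∀ z, z ∉ s → 2 * j ≤ (nbrs G z ∩ s).card) : False := by
  by_cases hu : s = Finset.univ
  · exact h.not_colorableOn (hu ▸ hsj.mono hj)
  obtain ⟨z, hz⟩ : ∃ z, z ∉ s := by
    by_contra! hcon
    exact hu (Finset.eq_univ_iff_forall.2 hcon)
  have hsplit : ∀ z, (nbrs G z ∩ s).card + (nbrs G z ∩ sᶜ).card = (nbrs G z).card := fun z => by
    rw [← Finset.sdiff_eq_inter_compl, Finset.card_inter_add_card_sdiff]
  have key := h.colorableOn_of_ne sᶜ (by
    obtain ⟨x, hx⟩ := hs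
    intro h'
    have := Finset.mem_univ x
    rw [← h'] at this
    simp [hx] at this) (d - 2 * j) w (fun x hx => by
      have := hd x (by simpa using hx)
      have := hsplit x
      have := h.card_nbrs_le x
      omega) (fun t _ ht => h.card_clique_le t ht)
  have := hsj.union key
  rw [Finset.union_compl] at this
  refine h.not_colorableOn (this.mono ?_)
  have := hd z hz
  have := hsplit z
  have := h.card_nbrs_le z
  have := h.bound_eq
  omega

end MinCounterexample
end

section
open scoped Classical

/-- An involution all of whose 2-cycles are non-edges of `G`, that is, a matching of the
complement of `G`. -/
structure Comatching {W : Type*} (G : SimpleGraph W) (f : W → W) : Prop where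
  involutive : Function.Involutive f
  not_adj : ∀ x, ¬G.Adj x (f x)

/-- The fixed points of `f`. -/
noncomputable def fixedPts {W : Type*} [Fintype W] (f : W → W) : Finset W :=
  Finset.univ.filter fun x => f x = x

/-- No three vertices are pairwise nonadjacent. -/
def NoThreeStable {W : Type*} (G : SimpleGraph W) (s : Finset W) : Prop :=
  ∀ x ∈ s, ∀ y ∈ s, ∀ z ∈ s, x ≠ y → x ≠ z → y ≠ z → ¬G.Adj x y → ¬G.Adj x z → G.Adj y z

namespace Comatching
variable {W : Type*} [Fintype W] {G : SimpleGraph W} {f g : W → W}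

theorem exists_rep (hf : Function.Involutive f) : ∃ r : Finset W,
    2 * r.card = Fintype.card W + (fixedPts f).card ∧ (∀ x, x ∈ r ∨ f x ∈ r) ∧
      ∀ x, x ∈ r → f x ∈ r → f x = x := by
  have e := Fintype.equivFin W
  set r : Finset W := Finset.univ.filter fun x => e x ≤ e (f x) with hr
  set r' : Finset W := Finset.univ.filter fun x => e (f x) ≤ e x with hr'
  have h1 : r.card = r'.card := by
    refine Finset.card_bij (fun x _ => f x) ?_ ?_ ?_
    · intro x hx
      simpa [hr, hr', hf x] using hx
    · intro x _ y _ h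
      exact hf.injective h
    · intro y hy
      exact ⟨f y, by simpa [hr, hr', hf y] using hy, hf y⟩
  have h2 : r ∪ r' = Finset.univ := by
    ext x
    simpa [hr, hr'] using le_total _ _
  have h3 : r ∩ r' = fixedPts f := by
    ext x
    simp only [hr, hr', fixedPts, Finset.mem_inter, Finset.mem_filter, Finset.mem_univ, true_and]
    refine ⟨fun h => (e.injective (le_antisymm h.1 h.2)).symm, fun h => by simp [h]⟩
  have h4 := Finset.card_union_add_card_inter r r'
  rw [h2, h3, Finset.card_univ] at h4
  refine ⟨r, by omega, fun x => ?_, fun x hx hx' => ?_⟩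
  · simpa [hr, hf x] using le_total _ _
  · simp only [hr, Finset.mem_filter, Finset.mem_univ, true_and, hf x] at hx hx'
    exact e.injective (le_antisymm hx' hx)

theorem colorableOn (hf : Comatching G f) {m : ℕ}
    (hm : Fintype.card W + (fixedPts f).card ≤ 2 * m) : ColorableOn G Finset.univ m := by
  obtain ⟨r, h1, h2, -⟩ := exists_rep hf.involutive
  refine colorableOn_of_card_image_le (fun x => if x ∈ r then x else f x) ?_ ?_
  · intro x _ y _ hxy h
    have hyx := hxy.symm
    by_cases hx : x ∈ r <;> by_cases hy : y ∈ r <;> simp only [hx, hy, if_true, if_false] at h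
    · exact hxy.ne h
    · exact hf.not_adj y (h ▸ hyx)
    · exact hf.not_adj x (h ▸ hxy)
    · exact hxy.ne (hf.involutive.injective h)
  · refine (Finset.card_le_card (t := r) fun x hx => ?_).trans (by omega)
    obtain ⟨y, -, rfl⟩ := Finset.mem_image.1 hx
    by_cases hy : y ∈ r <;> simp only [hy, if_true, if_false]
    exact (h2 y).resolve_left hy

theorem exists_of_coloring (hα : NoThreeStable G Finset.univ) {m : ℕ} {v : W}
    (h : ColorableOn G (Finset.univ.erase v) m) :
    ∃ f, Comatching G f ∧ f v = v ∧ Fintype.card W + (fixedPts f).card ≤ 2 * m + 2 := by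
  obtain ⟨c, hc1, hc2⟩ := h
  have hc1 : ∀ x, x ≠ v → c x < m := fun x hx => hc1 x (by simp [hx])
  have hc2 : ∀ x, x ≠ v → ∀ y, y ≠ v → G.Adj x y → c x ≠ c y :=
    fun x hx y hy => hc2 x (by simp [hx]) y (by simp [hy])
  have huniq : ∀ x y z, x ≠ v → y ≠ v → z ≠ v → x ≠ y → x ≠ z → c y = c x → c z = c x →
      y = z := by
    intro x y z hx hy hz hxy hxz h1 h2
    by_contra hyz
    have := hα x (by simp) y (by simp) z (by simp) hxy hxz hyz
      (fun h => hc2 x hx y hy h h1.symm) (fun h => hc2 x hx z hz h h2.symm)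
    exact hc2 y hy z hz this (h1.trans h2.symm)
  have hex : ∀ x, ∃ y, (x ≠ v ∧ y ≠ v ∧ y ≠ x ∧ c y = c x) ∨
      (y = x ∧ ¬∃ y, x ≠ v ∧ y ≠ v ∧ y ≠ x ∧ c y = c x) := by
    intro x
    by_cases h : ∃ y, x ≠ v ∧ y ≠ v ∧ y ≠ x ∧ c y = c x
    · exact ⟨h.choose, Or.inl h.choose_spec⟩
    · exact ⟨x, Or.inr ⟨rfl, h⟩⟩
  choose f hf using hex
  have hfeq : ∀ x y, x ≠ v → y ≠ v → y ≠ x → c y = c x → f x = y := by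
    intro x y hx hy hxy h
    rcases hf x with ⟨-, h2, h3, h4⟩ | ⟨-, h⟩
    · exact huniq x _ _ hx h2 hy h3.symm hxy.symm h4 h
    · exact absurd ⟨y, hx, hy, hxy, by assumption⟩ h
  have hinv : Function.Involutive f := by
    intro x
    rcases hf x with ⟨h1, h2, h3, h4⟩ | ⟨h1, -⟩
    · exact hfeq _ _ h2 h1 h3.symm h4.symm
    · rw [h1, h1]
  have hfv : f v = v := by
    rcases hf v with ⟨h1, -⟩ | ⟨h1, -⟩
    · exact absurd rfl h1
    · exact h1
  refine ⟨f, ⟨hinv, fun x hx => ?_⟩, hfv, ?_⟩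
  · rcases hf x with ⟨h1, h2, h3, h4⟩ | ⟨h1, -⟩
    · exact hc2 x h1 _ h2 hx h4.symm
    · rw [h1] at hx
      exact hx.ne rfl
  · obtain ⟨r, h1, -, h3⟩ := exists_rep hinv
    have h5 : (r.erase v).card ≤ (Finset.range m).card := by
      refine Finset.card_le_card_of_injOn c (fun x hx => ?_) fun x hx y hy hxy => ?_
      · simp only [Finset.coe_erase, Set.mem_sdiff, Set.mem_singleton_iff] at hx
        simpa using hc1 x hx.2
      · simp only [Finset.coe_erase, Set.mem_sdiff, Set.mem_singleton_iff, Finset.mem_coe] at hx hy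
        by_contra hne
        have h6 := hfeq x y hx.2 hy.2 (Ne.symm hne) hxy.symm
        exact hne (h6 ▸ (h3 x hx.1 (h6 ▸ hy.1)).symm)
    have h6 := Finset.pred_card_le_card_erase (s := r) (a := v)
    rw [Finset.card_range] at h5
    omega

theorem swap (hf : Comatching G f) (hg : Comatching G g) {s : Finset W}
    (hfs : ∀ x, x ∈ s ↔ f x ∈ s) (hgs : ∀ x, x ∈ s ↔ g x ∈ s) :
    Comatching G (fun x => if x ∈ s then g x else f x) ∧
      (fixedPts fun x => if x ∈ s then g x else f x).card + (fixedPts f ∩ s).card =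
        (fixedPts f).card + (fixedPts g ∩ s).card := by
  refine ⟨⟨fun x => ?_, fun x => ?_⟩, ?_⟩
  · by_cases hx : x ∈ s
    · simp only [hx, if_true, (hgs x).1 hx, hg.involutive x]
    · have : f x ∉ s := fun h => hx ((hfs x).2 h)
      simp only [hx, if_false, this, hf.involutive x]
  · by_cases hx : x ∈ s
    · simpa only [hx, if_true] using hg.not_adj x
    · simpa only [hx, if_false] using hf.not_adj x
  · have h1 : fixedPts (fun x => if x ∈ s then g x else f x) =
        (fixedPts f \ s) ∪ (fixedPts g ∩ s) := by
      ext x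
      by_cases hx : x ∈ s <;> simp [fixedPts, hx]
    rw [h1, Finset.card_union_of_disjoint, ← Finset.card_sdiff_add_card_inter (fixedPts f) s]
    · omega
    · rw [Finset.disjoint_left]
      intro x hx hy
      exact (Finset.mem_sdiff.1 hx).2 (Finset.mem_inter.1 hy).2

/-- In the component of a vertex under two involutions there are at most two fixed points. -/
theorem exists_component (hf : Function.Involutive f) (hg : Function.Involutive g) (t : W) :
    ∃ s : Finset W, t ∈ s ∧ (∀ x, x ∈ s ↔ f x ∈ s) ∧ (∀ x, x ∈ s ↔ g x ∈ s) ∧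
      (fixedPts f ∩ s).card + (fixedPts g ∩ s).card ≤ 2 := by
  let Γ : SimpleGraph W :=
    { Adj := fun x y => x ≠ y ∧ (f x = y ∨ g x = y)
      symm := ⟨fun x y (h : x ≠ y ∧ (f x = y ∨ g x = y)) => ⟨h.1.symm,
        h.2.imp (fun e : f x = y => e ▸ hf x) (fun e : g x = y => e ▸ hg x)⟩⟩
      loopless := ⟨fun x h => h.1 rfl⟩ }
  set s := Finset.univ.filter (fun x => Γ.Reachable t x) with hs
  have hcl : ∀ x, ∀ y, (f x = y ∨ g x = y) → Γ.Reachable x y := by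
    intro x y h
    by_cases hxy : x = y
    · exact hxy ▸ Reachable.refl _
    · exact Adj.reachable ⟨hxy, h⟩
  have hdeg : ∀ x, (nbrs Γ x).card + ((if f x = x then 1 else 0) + (if g x = x then 1 else 0)) ≤
      2 := by
    intro x
    have h1 : nbrs Γ x ⊆ ({f x, g x} : Finset W).erase x := by
      intro y hy
      have := mem_nbrs.1 hy
      simp only [Finset.mem_erase, Finset.mem_insert, Finset.mem_singleton]
      exact ⟨this.1.symm, this.2.imp Eq.symm Eq.symm⟩
    have h2 := Finset.card_le_card h1
    by_cases hfx : f x = x <;> by_cases hgx : g x = x <;> simp only [hfx, hgx, if_true, if_false]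
    · simp [hfx, hgx] at h2
      simp [h2]
    · have : ({x, g x} : Finset W).erase x ⊆ {g x} := by
        intro y
        simp +contextual
      have := Finset.card_le_card this
      rw [hfx] at h2
      simp only [Finset.card_singleton] at this
      omega
    · have : ({f x, x} : Finset W).erase x ⊆ {f x} := by
        intro y
        simp
        tauto
      have := Finset.card_le_card this
      rw [hgx] at h2
      simp only [Finset.card_singleton] at this
      omega
    · exact h2.trans ((Finset.card_erase_le).trans (Finset.card_insert_le _ _))
  have hsum := Finset.sum_le_sum (fun x (_ : x ∈ s) => hdeg x)
  rw [Finset.sum_add_distrib, Finset.sum_add_distrib, ← Finset.card_filter, ← Finset.card_filter,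
    Finset.sum_const, smul_eq_mul] at hsum
  have hfix : ∀ e : W → W, fixedPts e ∩ s = s.filter fun x => e x = x := by
    intro e
    ext x
    simp [fixedPts, and_comm]
  have := two_mul_card_reachable_le (G := Γ) (t := t) (s := s) (by simp [hs])
  refine ⟨s, by simp [hs], fun x => ?_, fun x => ?_, ?_⟩
  · simp only [hs, Finset.mem_filter, Finset.mem_univ, true_and]
    exact ⟨fun h => h.trans (hcl _ _ (Or.inl rfl)), fun h => h.trans (hcl _ _ (Or.inl rfl)).symm⟩
  · simp only [hs, Finset.mem_filter, Finset.mem_univ, true_and]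
    exact ⟨fun h => h.trans (hcl _ _ (Or.inr rfl)), fun h => h.trans (hcl _ _ (Or.inr rfl)).symm⟩
  · rw [hfix, hfix]
    omega

end Comatching

/-- A vertex-critical graph with connected complement and without three pairwise nonadjacent
vertices has more than twice as many vertices as it needs colours, minus two. -/
theorem two_mul_lt_card_of_noThreeStable {W : Type*} [Fintype W] {G : SimpleGraph W} {m : ℕ}
    (hα : NoThreeStable G Finset.univ)
    (hco : ∀ s : Finset W, s.Nonempty → s ≠ Finset.univ → ∃ y ∈ s, ∃ z, z ∉ s ∧ ¬G.Adj y z)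
    (hn : ¬ColorableOn G Finset.univ m)
    (hcrit : ∀ v, ∀ s : Finset W, v ∉ s → ColorableOn G s m) : 2 * m + 1 ≤ Fintype.card W := by
  by_contra! hlt
  have hmin : ∀ f, Comatching G f → 2 * m + 2 ≤ Fintype.card W + (fixedPts f).card := by
    intro f hf
    by_contra! h
    obtain ⟨r, hr, -⟩ := Comatching.exists_rep hf.involutive
    exact hn (hf.colorableOn (by omega))
  let N : W → W → Prop := fun u v => u = v ∨ ∀ f, Comatching G f →
    Fintype.card W + (fixedPts f).card = 2 * m + 2 → f u = u → f v = v → False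
  have hex : ∀ v, ∃ f, Comatching G f ∧ f v = v ∧
      Fintype.card W + (fixedPts f).card = 2 * m + 2 := by
    intro v
    obtain ⟨f, hf, hv, hle⟩ := Comatching.exists_of_coloring hα (hcrit v _ (Finset.notMem_erase v _))
    exact ⟨f, hf, hv, le_antisymm hle (hmin f hf)⟩
  have hnon : ∀ u v, ¬G.Adj u v → N u v := by
    intro u v huv
    by_contra hN
    simp only [N, not_or, not_forall] at hN
    obtain ⟨hne, f, hf, hcard, hu, hv, -⟩ := hN
    have hfu : ∀ x, f x = u ↔ x = u := fun x =>
      ⟨fun h => hf.involutive.injective (h.trans hu.symm), fun h => h ▸ hu⟩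
    have hfv : ∀ x, f x = v ↔ x = v := fun x =>
      ⟨fun h => hf.involutive.injective (h.trans hv.symm), fun h => h ▸ hv⟩
    set g : W → W := fun x => if x = u then v else if x = v then u else f x with hg
    have hgc : Comatching G g := by
      refine ⟨fun x => ?_, fun x => ?_⟩
      · by_cases h1 : x = u
        · simp [hg, h1, Ne.symm hne]
        · by_cases h2 : x = v
          · simp [hg, h2, Ne.symm hne]
          · simp [hg, h1, h2, hfu, hfv, hf.involutive x]
      · by_cases h1 : x = u
        · simpa [hg, h1] using huv
        · by_cases h2 : x = v
          · simpa [hg, h2, Ne.symm hne] using fun h => huv (Adj.symm h)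
          · simpa [hg, h1, h2] using hf.not_adj x
    have hsub : fixedPts g ⊆ ((fixedPts f).erase u).erase v := by
      intro x hx
      have hx : g x = x := by simpa [fixedPts] using hx
      by_cases h1 : x = u
      · simp [hg, h1, Ne.symm hne] at hx
      · by_cases h2 : x = v
        · simp [hg, h2, Ne.symm hne, hne] at hx
        · simpa [fixedPts, hg, h1, h2] using hx
    have hle := Finset.card_le_card hsub
    rw [Finset.card_erase_of_mem (by simp [fixedPts, hv, Ne.symm hne]),
      Finset.card_erase_of_mem (by simp [fixedPts, hu])] at hle
    have := hmin g hgc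
    omega
  have hsymm : ∀ u v, N u v → N v u := by
    rintro u v (h | h)
    · exact Or.inl h.symm
    · exact Or.inr fun f h1 h2 h3 h4 => h f h1 h2 h4 h3
  have htrans : ∀ u t v, N u t → N t v → N u v := by
    intro u t v hut htv
    by_contra hN
    simp only [N, not_or, not_forall] at hN
    obtain ⟨hne, f, hf, hcard, hu, hv, -⟩ := hN
    obtain ⟨g, hg, ht, hcard'⟩ := hex t
    obtain ⟨s, hts, hfs, hgs, hle⟩ := Comatching.exists_component hf.involutive hg.involutive t
    obtain ⟨hc1, hc2⟩ := hf.swap hg hfs hgs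
    obtain ⟨hc3, hc4⟩ := hg.swap hf hgs hfs
    have h1 := hmin _ hc1
    have h2 := hmin _ hc3
    have h3 : 0 < (fixedPts g ∩ s).card := Finset.card_pos.2 ⟨t, by simp [fixedPts, ht, hts]⟩
    have key : ∀ x, f x = x → N x t → x ∈ s := by
      intro x hx hxt
      by_contra hxs
      rcases hxt with rfl | hxt
      · exact hxs hts
      · exact hxt _ hc1 (by omega) (by simp [hxs, hx]) (by simp [hts, ht])
    have h4 : ({u, v} : Finset W) ⊆ fixedPts f ∩ s := by
      intro x hx
      simp only [Finset.mem_insert, Finset.mem_singleton] at hx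
      rcases hx with rfl | rfl
      · simp [fixedPts, hu, key _ hu hut]
      · simp [fixedPts, hv, key _ hv (hsymm _ _ htv)]
    have h5 := Finset.card_le_card h4
    rw [Finset.card_pair hne] at h5
    omega
  have hall : ∀ u v, N u v := by
    intro u
    by_contra! hcon
    obtain ⟨v, hv⟩ := hcon
    obtain ⟨y, hy, z, hz, hyz⟩ := hco (Finset.univ.filter fun y => N u y) ⟨u, by simp [N]⟩
      (fun h => hv (by simpa using (Finset.ext_iff.1 h v).2 (Finset.mem_univ v)))
    exact hz (by simpa using htrans u y z (by simpa using hy) (hnon y z hyz))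
  have hW : Nonempty W := by
    by_contra hW
    rw [not_nonempty_iff] at hW
    exact hn ⟨fun _ => 0, fun x => hW.elim x, fun x => hW.elim x⟩
  obtain ⟨v⟩ := hW
  obtain ⟨f, hf, -, hcard⟩ := hex v
  obtain ⟨a, ha, b, hb, hab⟩ := Finset.one_lt_card.1 (show 1 < (fixedPts f).card by omega)
  rcases hall a b with h | h
  · exact hab h
  · exact h f hf hcard (by simpa [fixedPts] using ha) (by simpa [fixedPts] using hb)
end

section
open scoped Classical
variable {V : Type*}

theorem colorableOn_comap_iff {G : SimpleGraph V} {s : Finset V} {t : Finset s} {m : ℕ} :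
    ColorableOn (G.comap (Subtype.val : s → V)) t m ↔
      ColorableOn G (t.map (Function.Embedding.subtype _)) m := by
  constructor
  · rintro ⟨c, h1, h2⟩
    refine ⟨fun x => if h : x ∈ s then c ⟨x, h⟩ else 0, ?_, ?_⟩
    · intro x hx
      obtain ⟨y, hy, rfl⟩ := Finset.mem_map.1 hx
      simpa using h1 y hy
    · intro x hx y hy hxy
      obtain ⟨x, hx', rfl⟩ := Finset.mem_map.1 hx
      obtain ⟨y, hy', rfl⟩ := Finset.mem_map.1 hy
      simpa using h2 x hx' y hy' hxy
  · rintro ⟨c, h1, h2⟩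
    exact ⟨fun x => c x, fun x hx => h1 x (Finset.mem_map_of_mem _ hx), fun x hx y hy hxy =>
      h2 x (Finset.mem_map_of_mem _ hx) y (Finset.mem_map_of_mem _ hy) hxy⟩

theorem map_subtype_univ (s : Finset V) :
    (Finset.univ : Finset s).map (Function.Embedding.subtype _) = s := by
  ext x
  simp

theorem ColorableOn.subset {G : SimpleGraph V} {s t : Finset V} {k : ℕ} (h : ColorableOn G t k)
    (hst : s ⊆ t) : ColorableOn G s k := by
  obtain ⟨c, h1, h2⟩ := h
  exact ⟨c, fun x hx => h1 x (hst hx), fun x hx y hy => h2 x (hst hx) y (hst hy)⟩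

/-- `two_mul_lt_card_of_noThreeStable` for an induced subgraph. -/
theorem two_mul_lt_card_of_noThreeStable_on {G : SimpleGraph V} {s : Finset V} {m : ℕ}
    (hα : NoThreeStable G s)
    (hco : ∀ t ⊆ s, t.Nonempty → t ≠ s → ∃ y ∈ t, ∃ z ∈ s, z ∉ t ∧ ¬G.Adj y z)
    (hn : ¬ColorableOn G s m) (hcrit : ∀ v ∈ s, ColorableOn G (s.erase v) m) :
    2 * m + 1 ≤ s.card := by
  have := two_mul_lt_card_of_noThreeStable (G := G.comap (Subtype.val : s → V)) (m := m)
    (fun x _ y _ z _ hxy hxz hyz => hα x x.2 y y.2 z z.2 (fun h => hxy (Subtype.ext h))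
      (fun h => hxz (Subtype.ext h)) fun h => hyz (Subtype.ext h))
    (fun t ht htu => by
      obtain ⟨y, hy, z, hz, hzt, hyz⟩ := hco (t.map (Function.Embedding.subtype _))
        (fun x hx => by
          obtain ⟨y, -, rfl⟩ := Finset.mem_map.1 hx
          exact y.2) (ht.map) (fun h => htu (by
          ext x
          simpa using (Finset.ext_iff.1 h x).2 x.2))
      obtain ⟨y, hy', rfl⟩ := Finset.mem_map.1 hy
      exact ⟨y, hy', ⟨z, hz⟩, fun h => hzt (Finset.mem_map_of_mem _ h), hyz⟩)
    (fun h => hn (by simpa only [map_subtype_univ] using colorableOn_comap_iff.1 h))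
    (fun v t hvt => colorableOn_comap_iff.2 ((hcrit v v.2).subset fun x hx => by
      obtain ⟨y, hy, rfl⟩ := Finset.mem_map.1 hx
      exact Finset.mem_erase.2 ⟨fun h => hvt (Subtype.ext h ▸ hy), y.2⟩))
  simpa using this

/-- `s` is a set of pairwise nonadjacent vertices. -/
def StableOn (G : SimpleGraph V) (s : Finset V) : Prop :=
  ∀ x ∈ s, ∀ y ∈ s, ¬G.Adj x y

theorem StableOn.colorableOn {G : SimpleGraph V} {s : Finset V} (hs : StableOn G s) :
    ColorableOn G s 1 :=
  ⟨fun _ => 0, fun _ _ => zero_lt_one, fun x hx y hy hxy => absurd hxy (hs x hx y hy)⟩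

theorem StableOn.exists_maximal [Fintype V] {G : SimpleGraph V} {s t : Finset V}
    (hs : StableOn G s) (hst : s ⊆ t) :
    ∃ u, s ⊆ u ∧ u ⊆ t ∧ StableOn G u ∧ ∀ z ∈ t, z ∉ u → ∃ y ∈ u, G.Adj z y := by
  obtain ⟨u, hu, hmax⟩ := Finset.exists_max_image
    (Finset.univ.filter fun u => s ⊆ u ∧ u ⊆ t ∧ StableOn G u) Finset.card
    ⟨s, by simp [hst, hs]⟩
  simp only [Finset.mem_filter, Finset.mem_univ, true_and] at hu hmax
  refine ⟨u, hu.1, hu.2.1, hu.2.2, fun z hz hzu => ?_⟩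
  by_contra! hcon
  have := hmax (insert z u) ⟨hu.1.trans (Finset.subset_insert _ _),
    Finset.insert_subset hz hu.2.1, fun x hx y hy => by
      rcases Finset.mem_insert.1 hx with rfl | hx' <;>
        rcases Finset.mem_insert.1 hy with rfl | hy'
      · exact G.irrefl
      · exact hcon y hy'
      · exact fun h => hcon x hx' h.symm
      · exact hu.2.2 x hx' y hy'⟩
  rw [Finset.card_insert_of_notMem hzu] at this
  omega

theorem exists_stableOn_of_not_noThreeStable {G : SimpleGraph V} {t : Finset V}
    (h : ¬NoThreeStable G t) : ∃ s ⊆ t, StableOn G s ∧ s.card = 3 := by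
  simp only [NoThreeStable, not_forall] at h
  obtain ⟨x, hx, y, hy, z, hz, hxy, hxz, hyz, h1, h2, h3⟩ := h
  refine ⟨{x, y, z}, by simp [Finset.insert_subset_iff, hx, hy, hz], ?_, ?_⟩
  · intro a ha b hb
    simp only [Finset.mem_insert, Finset.mem_singleton] at ha hb
    rcases ha with rfl | rfl | rfl <;> rcases hb with rfl | rfl | rfl <;>
      simp [h1, h2, h3, mt Adj.symm h1, mt Adj.symm h2, mt Adj.symm h3]
  · rw [Finset.card_eq_three]
    exact ⟨x, y, z, hxy, hxz, hyz, rfl⟩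

namespace MinCounterexample
variable [Fintype V] {G : SimpleGraph V} {d w k : ℕ}

theorem two_le_clique (h : MinCounterexample G d w k) {x y : V} (hxy : G.Adj x y) : 2 ≤ w := by
  have := h.card_clique_le {x, y} (by
    intro a ha b hb hab
    simp only [Finset.mem_insert, Finset.mem_singleton] at ha hb
    rcases ha with rfl | rfl <;> rcases hb with rfl | rfl
    · exact absurd rfl hab
    · exact hxy
    · exact hxy.symm
    · exact absurd rfl hab)
  rwa [Finset.card_pair hxy.ne] at this

theorem compl_ne_univ {s : Finset V} (hs : s.Nonempty) : sᶜ ≠ Finset.univ := by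
  obtain ⟨x, hx⟩ := hs
  intro h'
  have := Finset.mem_univ x
  rw [← h'] at this
  simp [hx] at this

theorem not_complete_of_noThreeStable (h : MinCounterexample G d w k) {s : Finset V}
    (hs : s.Nonempty) (hs' : s ≠ Finset.univ) (hc : ∀ x ∈ s, ∀ y, y ∉ s → G.Adj x y)
    (hα : NoThreeStable G s) : False := by
  obtain ⟨K, hK, hmin⟩ := Finset.exists_min_image
    (Finset.univ.filter fun u => u ⊆ s ∧ u.Nonempty ∧ ∀ x ∈ u, ∀ y, y ∉ u → G.Adj x y) Finset.card
    ⟨s, by simpa [hs] using hc⟩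
  simp only [Finset.mem_filter, Finset.mem_univ, true_and] at hK hmin
  obtain ⟨hKs, hKn, hKc⟩ := hK
  obtain ⟨z, hz⟩ : ∃ z, z ∉ K := by
    by_contra! hcon
    exact hs' (Finset.eq_univ_iff_forall.2 fun x => hKs (hcon x))
  obtain ⟨a, ha⟩ := hKn
  have hex : ∃ c, ColorableOn G Kᶜ c := ⟨k, h.crit (compl_ne_univ ⟨a, ha⟩)⟩
  set c := Nat.find hex with hcdef
  have hcol : ColorableOn G Kᶜ c := Nat.find_spec hex
  have hck : c ≤ k := Nat.find_min' hex (h.crit (compl_ne_univ ⟨a, ha⟩))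
  have hsplit : ∀ x, x ∉ K → K.card + (nbrs G x ∩ Kᶜ).card = (nbrs G x).card := fun x hx => by
    have : K = nbrs G x ∩ K := by
      ext y
      simpa using fun hy => (hKc y hy x hx).symm
    rw [← Finset.card_inter_add_card_sdiff (nbrs G x) K, ← this, Finset.sdiff_eq_inter_compl]
  have hw := h.two_le_clique (hKc a ha z hz)
  have hbound := Nat.find_min' hex (h.colorableOn_of_ne Kᶜ (compl_ne_univ ⟨a, ha⟩)
    (d - K.card) (w - 1) (fun x hx => by
      have := hsplit x (by simpa using hx)
      have := h.card_nbrs_le x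
      omega) (fun t ht htc => by
      have := h.card_clique_le (insert a t) (fun x hx y hy hxy => by
        rcases Finset.mem_insert.1 hx with rfl | hx' <;>
          rcases Finset.mem_insert.1 hy with rfl | hy'
        · exact absurd rfl hxy
        · exact hKc x ha y (by simpa using ht hy')
        · exact (hKc y ha x (by simpa using ht hx')).symm
        · exact htc x hx' y hy' hxy)
      rw [Finset.card_insert_of_notMem (fun hat => (Finset.mem_compl.1 (ht hat)) ha)] at this
      omega))
  have hgal := two_mul_lt_card_of_noThreeStable_on (G := G) (s := K) (m := k - c)
    (fun x hx y hy z hz => hα x (hKs hx) y (hKs hy) z (hKs hz))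
    (fun t ht htn htK => by
      by_contra! hcon
      have := hmin t ⟨ht.trans hKs, htn, fun x hx y hy => by
        by_cases hyK : y ∈ K
        · exact hcon x hx y hyK hy
        · exact hKc x (ht hx) y hyK⟩
      exact htK (Finset.eq_of_subset_of_card_le ht this))
    (fun hm => by
      have := hm.union hcol
      rw [Finset.union_compl, Nat.sub_add_cancel hck] at this
      exact h.not_colorableOn this)
    (fun v hv => by
      obtain ⟨e, he1, he2⟩ := h.exists_coloring v
      have hne : ∀ x ∈ K.erase v ∪ Kᶜ, x ≠ v := by
        rintro x hx rfl
        simp [hv] at hx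
      refine colorableOn_of_complete (t := Kᶜ) (c := e) (k := k) (fun x hx => he1 x (hne x hx))
        (fun x hx y hy => he2 x (hne x hx) y (hne y hy))
        (fun x hx y hy => hKc x (Finset.mem_of_mem_erase hx) y (by simpa using hy)) ?_
      have : c ≤ (Finset.image e Kᶜ).card := Nat.find_min' hex
        (colorableOn_of_card_image_le e (fun x hx y hy => he2 x
          (hne x (Finset.mem_union_right _ hx)) y (hne y (Finset.mem_union_right _ hy))) le_rfl)
      omega)
  have := hsplit z hz
  have := h.card_nbrs_le z
  have := h.bound_eq
  omega

theorem exists_not_adj_compl (h : MinCounterexample G d w k) {s : Finset V} (hs : s.Nonempty)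
    (hs' : s ≠ Finset.univ) : ∃ x ∈ s, ∃ y, y ∉ s ∧ ¬G.Adj x y := by
  by_contra! hcon
  have hcon' : ∀ x ∈ sᶜ, ∀ y, y ∉ sᶜ → G.Adj x y := fun x hx y hy =>
    (hcon y (by simpa using hy) x (by simpa using hx)).symm
  have hsc : sᶜ.Nonempty := by
    by_contra! hcon
    exact hs' (by simpa using hcon)
  obtain ⟨s₁, hs₁, hst₁, hc₁⟩ := exists_stableOn_of_not_noThreeStable
    (h.not_complete_of_noThreeStable hs hs' hcon)
  obtain ⟨s₂, hs₂, hst₂, hc₂⟩ := exists_stableOn_of_not_noThreeStable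
    (h.not_complete_of_noThreeStable hsc (compl_ne_univ hs) hcon')
  obtain ⟨t₁, hst₁, ht₁, hts₁, hm₁⟩ := hst₁.exists_maximal hs₁
  obtain ⟨t₂, hst₂, ht₂, hts₂, hm₂⟩ := hst₂.exists_maximal hs₂
  have hl₁ := Finset.card_le_card hst₁
  have hl₂ := Finset.card_le_card hst₂
  have key : ∀ z (t t' : Finset V), (∃ y ∈ t, G.Adj z y) → (∀ y ∈ t', G.Adj z y) →
      Disjoint t t' → 3 ≤ t'.card → 2 * 2 ≤ (nbrs G z ∩ (t ∪ t')).card := by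
    rintro z t t' ⟨y, hy, hzy⟩ hz hd hc
    have : insert y t' ⊆ nbrs G z ∩ (t ∪ t') := by
      intro x hx
      rcases Finset.mem_insert.1 hx with rfl | hx
      · simp [hzy, hy]
      · simp [hz x hx, hx]
    have := Finset.card_le_card this
    rw [Finset.card_insert_of_notMem (Finset.disjoint_left.1 hd hy)] at this
    omega
  have hdis : Disjoint t₁ t₂ := by
    rw [Finset.disjoint_left]
    exact fun x hx hx' => Finset.mem_compl.1 (ht₂ hx') (ht₁ hx)
  obtain ⟨x, hx⟩ := hs
  obtain ⟨y, hy⟩ := hsc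
  have hw := h.two_le_clique (hcon x hx y (by simpa using hy))
  have hd : 0 < (nbrs G x).card := Finset.card_pos.2
    ⟨y, mem_nbrs.2 (hcon x hx y (by simpa using hy))⟩
  have hd' := h.card_nbrs_le x
  have hk := h.bound_eq
  refine h.reduce (s := t₁ ∪ t₂) (j := 1 + 1) ?_ (by omega)
    (hts₁.colorableOn.union hts₂.colorableOn) fun z hz => ?_
  · exact (Finset.card_pos.1 (by omega : 0 < t₁.card)).mono Finset.subset_union_left
  · simp only [Finset.mem_union, not_or] at hz
    by_cases hzs : z ∈ s
    · exact key z _ _ (hm₁ z hzs hz.1) (fun y hy => hcon z hzs y (by simpa using ht₂ hy)) hdis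
        (by omega)
    · rw [Finset.union_comm]
      exact key z _ _ (hm₂ z (by simpa using hzs) hz.2)
        (fun y hy => (hcon y (ht₁ hy) z hzs).symm) hdis.symm (by omega)

theorem not_noThreeStable (h : MinCounterexample G d w k) :
    ¬NoThreeStable G Finset.univ := by
  intro hα
  have hgal := two_mul_lt_card_of_noThreeStable hα (fun s => h.exists_not_adj_compl)
    h.not_colorableOn (fun v s hv => h.crit fun hs => hv (hs ▸ Finset.mem_univ v))
  obtain ⟨x⟩ := h.nonempty
  have h1 := h.card_clique_le (insert x (nbrs G x))ᶜ (fun a ha b hb hab => by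
    simp only [Finset.mem_compl, Finset.mem_insert, mem_nbrs, not_or] at ha hb
    exact hα x (by simp) a (by simp) b (by simp) (Ne.symm ha.1) (Ne.symm hb.1) hab ha.2 hb.2)
  rw [Finset.card_compl, Finset.card_insert_of_notMem (by simp)] at h1
  have := h.card_nbrs_le x
  have := h.bound_eq
  omega

end MinCounterexample
end

section
open scoped Classical
variable {V : Type*}

theorem exists_injOn_of_card_le {s t : Finset ℕ} (h : s.card ≤ t.card) :
    ∃ σ : ℕ → ℕ, (∀ x ∈ s, ∀ y ∈ s, σ x = σ y → x = y) ∧ ∀ x ∈ s, σ x ∈ t := by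
  obtain ⟨e⟩ := Function.Embedding.nonempty_of_card_le (α := s) (β := t) (by simpa using h)
  refine ⟨fun x => if hx : x ∈ s then e ⟨x, hx⟩ else 0, fun x hx y hy hxy => ?_, fun x hx => ?_⟩
  · simpa [hx, hy, Subtype.ext_iff] using hxy
  · simp [hx]

/-- Given two proper colourings `f`, `g` of `q`, there is one that takes only colours of `g` and no
more colours than `f` does. -/
theorem exists_recoloring {G : SimpleGraph V} {q : Finset V} {f g : V → ℕ}
    (hf : ∀ x ∈ q, ∀ y ∈ q, G.Adj x y → f x ≠ f y) (hg : ∀ x ∈ q, ∀ y ∈ q, G.Adj x y → g x ≠ g y) :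
    ∃ e : V → ℕ, (∀ x ∈ q, ∃ u ∈ q, e x = g u) ∧ (∀ x ∈ q, ∀ y ∈ q, G.Adj x y → e x ≠ e y) ∧
      (q.image e).card ≤ (q.image f).card := by
  by_cases h : (q.image f).card ≤ (q.image g).card
  · obtain ⟨σ, h1, h2⟩ := exists_injOn_of_card_le h
    refine ⟨fun x => σ (f x), fun x hx => ?_, fun x hx y hy hxy he => ?_, ?_⟩
    · obtain ⟨u, hu, hux⟩ := Finset.mem_image.1 (h2 _ (Finset.mem_image_of_mem f hx))
      exact ⟨u, hu, hux.symm⟩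
    · exact hf x hx y hy hxy
        (h1 _ (Finset.mem_image_of_mem f hx) _ (Finset.mem_image_of_mem f hy) he)
    · rw [← Function.comp_def, ← Finset.image_image]
      exact Finset.card_image_le
  · exact ⟨g, fun x hx => ⟨x, hx, rfl⟩, hg, by omega⟩

namespace MinCounterexample
variable [Fintype V] {G : SimpleGraph V} {d w k : ℕ}

/-- A minimal counterexample has no proper module containing an edge. -/
theorem not_module (h : MinCounterexample G d w k) {M : Finset V}
    (hM : ∀ z, z ∉ M → ∀ x ∈ M, ∀ y ∈ M, G.Adj z x → G.Adj z y) {x₀ x₁ : V} (h₀ : x₀ ∈ M)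
    (h₁ : x₁ ∈ M) (hadj : G.Adj x₀ x₁) (hne : M ≠ Finset.univ) : False := by
  obtain ⟨A, hA⟩ : ∃ A : Finset V, ∀ z, z ∈ A ↔ z ∉ M ∧ G.Adj z x₀ :=
    ⟨Finset.univ.filter fun z => z ∉ M ∧ G.Adj z x₀, by simp⟩
  have hAM : ∀ x ∈ M, ∀ a ∈ A, G.Adj x a := fun x hx a ha =>
    (hM a ((hA a).1 ha).1 x₀ h₀ x hx ((hA a).1 ha).2).symm
  have hBM : ∀ z, z ∉ M → z ∉ A → ∀ x ∈ M, ¬G.Adj z x := fun z hz hzA x hx hzx =>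
    hzA ((hA z).2 ⟨hz, hM z hz x hx x₀ h₀ hzx⟩)
  obtain ⟨f, hfk, hf⟩ : ColorableOn G (M ∪ A) k := by
    refine h.crit fun hu => ?_
    obtain ⟨x, hx, y, hy, hxy⟩ := h.exists_not_adj_compl ⟨x₀, h₀⟩ hne
    have : y ∈ M ∪ A := hu ▸ Finset.mem_univ y
    exact hxy (hAM x hx y ((Finset.mem_union.1 this).resolve_left hy))
  obtain ⟨g, hgk, hg⟩ := h.crit (compl_ne_univ ⟨x₀, h₀⟩)
  simp only [Finset.mem_compl] at hgk hg
  let r : V → V → Prop := fun a b => a ∈ A ∧ b ∈ A ∧ ¬G.Adj a b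
  have hrsymm : ∀ a b, Relation.ReflTransGen r a b → Relation.ReflTransGen r b a := by
    intro a b hab
    induction hab with
    | refl => exact .refl
    | tail _ hbc ih => exact .head ⟨hbc.2.1, hbc.1, fun e => hbc.2.2 e.symm⟩ ih
  obtain ⟨cl, hcl⟩ : ∃ cl : V → Finset V, ∀ a b, b ∈ cl a ↔ Relation.ReflTransGen r a b :=
    ⟨fun a => Finset.univ.filter fun b => Relation.ReflTransGen r a b, by simp⟩
  have hself : ∀ a, a ∈ cl a := fun a => (hcl a a).2 .refl
  have hclA : ∀ a ∈ A, cl a ⊆ A := by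
    intro a ha b hb
    induction (hcl a b).1 hb with
    | refl => exact ha
    | tail _ hbc _ => exact hbc.2.1
  have hcleq : ∀ a b, b ∈ cl a → cl b = cl a := by
    intro a b hb
    ext x
    rw [hcl] at hb
    rw [hcl, hcl]
    exact ⟨hb.trans, (hrsymm _ _ hb).trans⟩
  have hclne : ∀ a ∈ A, ∀ b ∈ A, cl a ≠ cl b → ∀ u ∈ cl a, ∀ v ∈ cl b, G.Adj u v := by
    intro a ha b hb hab u hu v hv
    by_contra huv
    refine hab ?_
    rw [← hcleq a u hu, ← hcleq b v hv]
    exact (hcleq u v ((hcl u v).2 (.single ⟨hclA a ha hu, hclA b hb hv, huv⟩))).symm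
  have hhom : ∀ z, z ∉ M → z ∉ A → ∀ a ∈ A, G.Adj z a → ∀ b ∈ cl a, G.Adj z b := by
    intro z hz hzA a _ hza b hb
    induction (hcl a b).1 hb with
    | refl => exact hza
    | tail hb' hbc ih =>
      by_contra hzc
      exact h.kiteFree _ _ _ _ z hadj (hAM _ h₀ _ hbc.1) (hAM _ h₀ _ hbc.2.1) (hAM _ h₁ _ hbc.1)
        (hAM _ h₁ _ hbc.2.1) (ih ((hcl _ _).2 hb')).symm hbc.2.2 (hBM z hz hzA _ h₀)
        (hBM z hz hzA _ h₁) hzc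
  have hAc : ∀ a ∈ A, a ∉ M := fun a ha => ((hA a).1 ha).1
  have hrec : ∀ q : Finset V, ∃ e : V → ℕ, q ⊆ A → (∀ x ∈ q, ∃ u ∈ q, e x = g u) ∧
      (∀ x ∈ q, ∀ y ∈ q, G.Adj x y → e x ≠ e y) ∧ (q.image e).card ≤ (q.image f).card := by
    intro q
    by_cases hq : q ⊆ A
    · obtain ⟨e, he⟩ := exists_recoloring (G := G) (q := q) (f := f) (g := g)
        (fun x hx y hy => hf x (Finset.mem_union_right _ (hq hx)) y
          (Finset.mem_union_right _ (hq hy)))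
        (fun x hx y hy => hg x (hAc x (hq hx)) y (hAc y (hq hy)))
      exact ⟨e, fun _ => he⟩
    · exact ⟨f, fun hq' => absurd hq' hq⟩
  choose E hE using hrec
  have hE1 : ∀ a ∈ A, ∃ u ∈ cl a, E (cl a) a = g u := fun a ha =>
    (hE _ (hclA a ha)).1 a (hself a)
  have hcard : (A.image fun a => E (cl a) a).card ≤ (A.image f).card := by
    have h1 : (A.image fun a => E (cl a) a) ⊆ (A.image cl).biUnion fun q => q.image (E q) := by
      intro i hi
      obtain ⟨a, ha, rfl⟩ := Finset.mem_image.1 hi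
      exact Finset.mem_biUnion.2 ⟨cl a, Finset.mem_image_of_mem _ ha,
        Finset.mem_image_of_mem _ (hself a)⟩
    have h2 : ((A.image cl).biUnion fun q => q.image f) ⊆ A.image f := by
      intro i hi
      obtain ⟨q, hq, hi⟩ := Finset.mem_biUnion.1 hi
      obtain ⟨a, ha, rfl⟩ := Finset.mem_image.1 hq
      exact Finset.image_subset_image (hclA a ha) hi
    have h3 : ((A.image cl).biUnion fun q => q.image f).card =
        ∑ q ∈ A.image cl, (q.image f).card := by
      refine Finset.card_biUnion fun q hq q' hq' hqq => ?_
      obtain ⟨a, ha, rfl⟩ := Finset.mem_image.1 hq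
      obtain ⟨b, hb, rfl⟩ := Finset.mem_image.1 hq'
      refine Finset.disjoint_left.2 fun i hi hi' => ?_
      obtain ⟨u, hu, rfl⟩ := Finset.mem_image.1 hi
      obtain ⟨v, hv, huv⟩ := Finset.mem_image.1 hi'
      exact hf u (Finset.mem_union_right _ (hclA a ha hu)) v
        (Finset.mem_union_right _ (hclA b hb hv)) (hclne a ha b hb hqq u hu v hv) huv.symm
    refine (Finset.card_le_card h1).trans (Finset.card_biUnion_le.trans ?_)
    refine le_trans (Finset.sum_le_sum fun q hq => ?_) (h3.symm.le.trans (Finset.card_le_card h2))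
    obtain ⟨a, ha, rfl⟩ := Finset.mem_image.1 hq
    exact (hE _ (hclA a ha)).2.2
  obtain ⟨e, he1, he2⟩ : ColorableOn G M (k - (A.image f).card) :=
    colorableOn_of_complete hfk hf hAM (by omega)
  have hpal : (Finset.range (k - (A.image f).card)).card ≤
      (Finset.range k \ A.image fun a => E (cl a) a).card := by
    have := Finset.le_card_sdiff (A.image fun a => E (cl a) a) (Finset.range k)
    rw [Finset.card_range] at this ⊢
    omega
  obtain ⟨σ, hσ1, hσ2⟩ := exists_injOn_of_card_le hpal
  simp only [Finset.mem_range, Finset.mem_sdiff, Finset.mem_image, not_exists, not_and] at hσ1 hσ2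
  have hmix : ∀ x y, x ∈ A → y ∉ M → y ∉ A → G.Adj x y → E (cl x) x ≠ g y := by
    intro x y hx hy hyA hxy
    obtain ⟨u, hu, hu'⟩ := hE1 x hx
    rw [hu']
    exact hg u (hAc u (hclA x hx hu)) y hy (hhom y hy hyA x hx hxy.symm u hu).symm
  refine h.not_colorableOn ⟨fun x => if x ∈ M then σ (e x) else if x ∈ A then E (cl x) x else g x,
    fun x _ => ?_, fun x _ y _ hxy => ?_⟩
  · by_cases hx : x ∈ M
    · simpa [hx] using (hσ2 _ (he1 x hx)).1
    · by_cases hxA : x ∈ A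
      · obtain ⟨u, hu, hu'⟩ := hE1 x hxA
        simpa [hx, hxA, hu'] using hgk u (hAc u (hclA x hxA hu))
      · simpa [hx, hxA] using hgk x hx
  · by_cases hx : x ∈ M <;> by_cases hy : y ∈ M <;> simp only [hx, hy, if_true, if_false]
    · exact fun hσ => he2 x hx y hy hxy (hσ1 _ (he1 x hx) _ (he1 y hy) hσ)
    · by_cases hyA : y ∈ A
      · simpa only [hyA, if_true] using fun hσ => (hσ2 _ (he1 x hx)).2 y hyA hσ.symm
      · exact absurd hxy.symm (hBM y hy hyA x hx)
    · by_cases hxA : x ∈ A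
      · simpa only [hxA, if_true] using fun hσ => (hσ2 _ (he1 y hy)).2 x hxA hσ
      · exact absurd hxy (hBM x hx hxA y hy)
    · by_cases hxA : x ∈ A <;> by_cases hyA : y ∈ A <;> simp only [hxA, hyA, if_true, if_false]
      · by_cases hq : cl x = cl y
        · rw [← hq]
          exact (hE _ (hclA x hxA)).2.1 x (hself x) y (hq ▸ hself y) hxy
        · obtain ⟨u, hu, hu'⟩ := hE1 x hxA
          obtain ⟨v, hv, hv'⟩ := hE1 y hyA
          rw [hu', hv']
          exact hg u (hAc u (hclA x hxA hu)) v (hAc v (hclA y hyA hv))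
            (hclne x hxA y hyA hq u hu v hv)
      · exact hmix x y hxA hy hyA hxy
      · exact (hmix y x hyA hx hxA hxy.symm).symm
      · exact hg x hx y hy hxy

end MinCounterexample
end

section
open scoped Classical
theorem one_lt_card_sdiff {V : Type*} {s t : Finset V} (m : ℕ) (hs : m + 2 ≤ s.card)
    (ht : t.card ≤ m) : 1 < (s \ t).card := by
  have := Finset.le_card_sdiff t s
  omega

variable {V : Type*} [Fintype V] {G : SimpleGraph V} {S : Finset V}

/-- The neighbours of `x` in `S`. -/
noncomputable def nbrsIn (G : SimpleGraph V) (S : Finset V) (x : V) : Finset V :=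
  nbrs G x ∩ S

@[simp]
theorem mem_nbrsIn {x y : V} : y ∈ nbrsIn G S x ↔ G.Adj x y ∧ y ∈ S := by
  simp [nbrsIn]

theorem nbrsIn_subset_of_adj (hC : ChairFree G) (hS : StableOn G S) {v x : V} (hvx : G.Adj v x)
    (hlt : 1 < (nbrsIn G S v \ nbrsIn G S x).card) : nbrsIn G S x ⊆ nbrsIn G S v := by
  obtain ⟨a, ha, b, hb, hab⟩ := Finset.one_lt_card.1 hlt
  simp only [Finset.mem_sdiff, mem_nbrsIn, not_and] at ha hb
  intro s hs
  rw [mem_nbrsIn] at hs ⊢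
  refine ⟨?_, hs.2⟩
  by_contra hvs
  exact hC v a b x s ha.1.1 hb.1.1 hvx hs.1 hab (hS _ ha.1.2 _ hb.1.2)
    (fun h => ha.2 h.symm ha.1.2) (fun h => hb.2 h.symm hb.1.2) hvs (hS _ ha.1.2 _ hs.2)
    (hS _ hb.1.2 _ hs.2)

theorem adj_of_nbrsIn_inter (hC : ChairFree G) (hS : StableOn G S) {v x : V}
    (hlt : 1 < (nbrsIn G S v \ nbrsIn G S x).card) {u : V} (hu : u ∈ nbrsIn G S v)
    (hux : u ∈ nbrsIn G S x) : G.Adj v x := by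
  obtain ⟨a, ha, b, hb, hab⟩ := Finset.one_lt_card.1 hlt
  simp only [Finset.mem_sdiff, mem_nbrsIn, not_and] at ha hb hu hux
  by_contra hvx
  exact hC v a b u x ha.1.1 hb.1.1 hu.1 hux.1.symm hab (hS _ ha.1.2 _ hb.1.2)
    (hS _ ha.1.2 _ hu.2) (hS _ hb.1.2 _ hu.2) hvx (fun h => ha.2 h.symm ha.1.2)
    (fun h => hb.2 h.symm hb.1.2)

theorem nbrsIn_subset_of_inter (hC : ChairFree G) (hS : StableOn G S) {v x : V}
    (hlt : 1 < (nbrsIn G S v \ nbrsIn G S x).card) {u : V} (hu : u ∈ nbrsIn G S v)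
    (hux : u ∈ nbrsIn G S x) : nbrsIn G S x ⊆ nbrsIn G S v :=
  nbrsIn_subset_of_adj hC hS (adj_of_nbrsIn_inter hC hS hlt hu hux) hlt

theorem not_adj_of_notMem_nbrsIn (hC : ChairFree G) (hS : StableOn G S) {v x : V}
    (hlt : 1 < (nbrsIn G S v \ nbrsIn G S x).card) {u : V} (hu : u ∉ nbrsIn G S v)
    (hux : u ∈ nbrsIn G S x) : ¬G.Adj v x :=
  fun h => hu (nbrsIn_subset_of_adj hC hS h hlt hux)

/-- A pair `v`, `z` of nonadjacent vertices with neighbours `s, t, b` and `s, t` in `S`. -/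
structure ExceptionalPair (G : SimpleGraph V) (S : Finset V) (v z s t b : V) : Prop where
  nbrsIn_left : nbrsIn G S v = {s, t, b}
  nbrsIn_right : nbrsIn G S z = {s, t}
  not_adj : ¬G.Adj v z
  ne_st : s ≠ t
  ne_sb : s ≠ b
  ne_tb : t ≠ b

namespace ExceptionalPair
variable {v z s t b : V}

theorem swap (he : ExceptionalPair G S v z s t b) : ExceptionalPair G S v z t s b where
  nbrsIn_left := he.nbrsIn_left.trans (Finset.insert_comm _ _ _)
  nbrsIn_right := he.nbrsIn_right.trans (Finset.pair_comm _ _)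
  not_adj := he.not_adj
  ne_st := he.ne_st.symm
  ne_sb := he.ne_tb
  ne_tb := he.ne_sb

theorem mem_s (he : ExceptionalPair G S v z s t b) : G.Adj v s ∧ s ∈ S :=
  mem_nbrsIn.1 (by simp [he.nbrsIn_left])

theorem mem_b (he : ExceptionalPair G S v z s t b) : G.Adj v b ∧ b ∈ S :=
  mem_nbrsIn.1 (by simp [he.nbrsIn_left])

theorem adj_zs (he : ExceptionalPair G S v z s t b) : G.Adj z s :=
  (mem_nbrsIn.1 (by simp [he.nbrsIn_right] : s ∈ nbrsIn G S z)).1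

theorem not_adj_zb (he : ExceptionalPair G S v z s t b) : ¬G.Adj z b := fun h => by
  have : b ∈ nbrsIn G S z := mem_nbrsIn.2 ⟨h, he.mem_b.2⟩
  simp [he.nbrsIn_right, he.ne_sb.symm, he.ne_tb.symm] at this

theorem nbrsIn_ne (he : ExceptionalPair G S v z s t b) (hC : ChairFree G) (hK : KiteFree G)
    (hS : StableOn G S) (x : V) : nbrsIn G S x ≠ {s} := by
  intro hx
  have hc : (nbrsIn G S v).card = 3 := by
    rw [he.nbrsIn_left, Finset.card_eq_three]
    exact ⟨s, t, b, he.ne_st, he.ne_sb, he.ne_tb, rfl⟩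
  have hvx : G.Adj v x := adj_of_nbrsIn_inter hC hS (u := s)
    (one_lt_card_sdiff 1 hc.ge (by simp [hx])) (by simp [he.nbrsIn_left]) (by simp [hx])
  have hxs : G.Adj x s := (mem_nbrsIn.1 (by rw [hx]; simp : s ∈ nbrsIn G S x)).1
  have hxn : ∀ a ∈ S, a ≠ s → ¬G.Adj x a := fun a ha has h => has (by
    have : a ∈ nbrsIn G S x := mem_nbrsIn.2 ⟨h, ha⟩
    simpa [hx] using this)
  have hxz : G.Adj x z := by
    by_contra hxz
    exact hC v x b t z hvx he.mem_b.1 he.swap.mem_s.1 he.swap.adj_zs.symm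
      (fun h => hS _ he.mem_b.2 _ he.mem_s.2 (h ▸ hxs)) (hxn _ he.mem_b.2 he.ne_sb.symm)
      (hxn _ he.swap.mem_s.2 he.ne_st.symm) (hS _ he.mem_b.2 _ he.swap.mem_s.2) he.not_adj hxz
      (fun h => he.not_adj_zb h.symm)
  exact hK s x v z b hxs.symm he.mem_s.1.symm he.adj_zs.symm hvx.symm hxz he.mem_b.1 he.not_adj
    (hS _ he.mem_b.2 _ he.mem_s.2) (fun h => hxn _ he.mem_b.2 he.ne_sb.symm h.symm)
    fun h => he.not_adj_zb h.symm

theorem adj_of_nbrsIn_pair (he : ExceptionalPair G S v z s t b) (hC : ChairFree G)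
    (hK : KiteFree G) (hS : StableOn G S) {u x : V} (hu : nbrsIn G S u = {b, s})
    (hx : nbrsIn G S x = {b}) : G.Adj u x := by
  have hc : (nbrsIn G S v).card = 3 := by
    rw [he.nbrsIn_left, Finset.card_eq_three]
    exact ⟨s, t, b, he.ne_st, he.ne_sb, he.ne_tb, rfl⟩
  have hxb : G.Adj x b := (mem_nbrsIn.1 (by rw [hx]; simp : b ∈ nbrsIn G S x)).1
  have hub : G.Adj u b := (mem_nbrsIn.1 (by rw [hu]; simp : b ∈ nbrsIn G S u)).1
  have hus : G.Adj u s := (mem_nbrsIn.1 (by rw [hu]; simp : s ∈ nbrsIn G S u)).1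
  have hvu : G.Adj v u := by
    by_contra hvu
    refine nbrsIn_ne (G := G) (S := S) (v := v) (z := u) (s := b) (t := s) (b := t)
      ⟨?_, hu, hvu, he.ne_sb.symm, he.ne_tb.symm, he.ne_st⟩ hC hK hS x hx
    rw [he.nbrsIn_left]
    ext a
    simp only [Finset.mem_insert, Finset.mem_singleton]
    tauto
  have hvx : G.Adj v x := adj_of_nbrsIn_inter hC hS (u := b)
    (one_lt_card_sdiff 1 hc.ge (by simp [hx])) (by simp [he.nbrsIn_left]) (by simp [hx])
  have huz : G.Adj u z := by
    by_contra huz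
    exact hK v u s b z hvu he.mem_s.1 he.mem_b.1 hus hub he.adj_zs.symm
      (hS _ he.mem_s.2 _ he.mem_b.2) (fun h => he.not_adj h.symm) (fun h => huz h.symm)
      he.not_adj_zb
  have hzx : ¬G.Adj z x := by
    refine not_adj_of_notMem_nbrsIn hC hS (u := b) ?_
      (by simp [he.not_adj_zb]) (by simp [hx])
    rw [hx, Finset.sdiff_singleton_eq_erase, Finset.erase_eq_of_notMem (by simp [he.not_adj_zb]), he.nbrsIn_right,
      Finset.card_pair he.ne_st]
    exact one_lt_two
  by_contra hux
  exact hK b v u x z he.mem_b.1.symm hub.symm hxb.symm hvu hvx huz hux he.not_adj_zb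
    (fun h => he.not_adj h.symm) hzx

end ExceptionalPair

namespace MinCounterexample
variable {d w k : ℕ}

theorem not_module' (h : MinCounterexample G d w k) {M : Finset V}
    (hM : ∀ z, z ∉ M → (∀ x ∈ M, ¬G.Adj z x) ∨ ∀ x ∈ M, G.Adj z x) {x₀ x₁ x₂ : V} (h₀ : x₀ ∈ M)
    (h₁ : x₁ ∈ M) (hadj : G.Adj x₀ x₁) (h₂ : x₂ ∉ M) : False :=
  h.not_module (fun z hz x hx y hy hzx => (hM z hz).elim (fun h' => absurd hzx (h' x hx))
    fun h' => h' y hy) h₀ h₁ hadj fun hu => h₂ (hu ▸ Finset.mem_univ x₂)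

theorem nbrsIn_ne_of_exceptionalPair (h : MinCounterexample G d w k) (hS : StableOn G S)
    (hmax : ∀ x, x ∉ S → (nbrsIn G S x).Nonempty) {v z s t b : V}
    (he : ExceptionalPair G S v z s t b) {y : V} (hyS : y ∉ S) : nbrsIn G S y ≠ {b} := by
  intro hy
  have hC := h.chairFree
  have hK := h.kiteFree
  have hc : (nbrsIn G S v).card = 3 := by
    rw [he.nbrsIn_left, Finset.card_eq_three]
    exact ⟨s, t, b, he.ne_st, he.ne_sb, he.ne_tb, rfl⟩
  have hnb : ∀ x, nbrsIn G S x = {b} → ∀ u ∈ S, u ≠ b → ¬G.Adj x u := fun x hx u hu hub hxu =>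
    hub (by simpa [hx] using (mem_nbrsIn.2 ⟨hxu, hu⟩ : u ∈ nbrsIn G S x))
  have hadj : ∀ x, nbrsIn G S x = {b} → G.Adj x b := fun x hx =>
    (mem_nbrsIn.1 (by rw [hx]; simp : b ∈ nbrsIn G S x)).1
  obtain ⟨M, hM⟩ : ∃ M : Finset V, ∀ x, x ∈ M ↔ x = b ∨ (x ∉ S ∧ nbrsIn G S x = {b}) :=
    ⟨Finset.univ.filter fun x => x = b ∨ (x ∉ S ∧ nbrsIn G S x = {b}), by simp⟩
  refine h.not_module' (M := M) (fun u hu => ?_) ((hM b).2 (.inl rfl)) ((hM y).2 (.inr ⟨hyS, hy⟩))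
    (hadj y hy).symm (x₂ := s) fun hs => ((hM s).1 hs).elim he.ne_sb fun h' => h'.1 he.mem_s.2
  rw [hM, not_or, not_and] at hu
  by_cases huS : u ∈ S
  · refine .inl fun x hx => ?_
    rcases (hM x).1 hx with rfl | ⟨-, hx⟩
    · exact hS _ huS _ he.mem_b.2
    · exact fun h' => hnb x hx u huS hu.1 h'.symm
  by_cases hub : b ∈ nbrsIn G S u
  · refine .inr fun x hx => ?_
    rcases (hM x).1 hx with rfl | ⟨-, hx⟩
    · exact (mem_nbrsIn.1 hub).1
    have hne : 1 < (nbrsIn G S u).card := by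
      by_contra hle
      exact hu.2 huS (Finset.eq_singleton_iff_unique_mem.2
        ⟨hub, fun a ha => Finset.card_le_one.1 (by omega) a ha b hub⟩)
    by_cases h3 : 3 ≤ (nbrsIn G S u).card
    · exact adj_of_nbrsIn_inter hC hS (one_lt_card_sdiff 1 h3 (by simp [hx])) hub
        (by simp [hx])
    obtain ⟨c, hc', hcb⟩ := Finset.exists_mem_ne hne b
    have hu2 : nbrsIn G S u = {b, c} := (Finset.eq_of_subset_of_card_le
      (Finset.insert_subset hub (Finset.singleton_subset_iff.2 hc'))
      (by rw [Finset.card_pair hcb.symm]; omega)).symm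
    have hcv : c ∈ nbrsIn G S v := by
      by_contra hcv
      refine hcv (nbrsIn_subset_of_inter hC hS ?_ (u := b) (by simp [he.nbrsIn_left]) hub hc')
      have : nbrsIn G S v \ nbrsIn G S u = nbrsIn G S v \ {b} := by
        ext a
        simp only [hu2, Finset.mem_sdiff, Finset.mem_insert, Finset.mem_singleton, not_or]
        exact ⟨fun h' => ⟨h'.1, h'.2.1⟩, fun h' => ⟨h'.1, h'.2, fun e => hcv (e ▸ h'.1)⟩⟩
      rw [this]
      exact one_lt_card_sdiff 1 hc.ge (by simp)
    rw [he.nbrsIn_left] at hcv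
    simp only [Finset.mem_insert, Finset.mem_singleton, hcb, or_false] at hcv
    rcases hcv with rfl | rfl
    · exact he.adj_of_nbrsIn_pair hC hK hS hu2 hx
    · exact he.swap.adj_of_nbrsIn_pair hC hK hS hu2 hx
  · refine .inl fun x hx => ?_
    rcases (hM x).1 hx with rfl | ⟨-, hx⟩
    · exact fun h' => hub (mem_nbrsIn.2 ⟨h', he.mem_b.2⟩)
    intro hux
    obtain ⟨c, hcu⟩ := hmax u huS
    have hle : (nbrsIn G S u).card ≤ 1 := by
      by_contra hlt
      refine not_adj_of_notMem_nbrsIn hC hS ?_ hub (by simp [hx]) hux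
      rw [hx, Finset.sdiff_singleton_eq_erase, Finset.erase_eq_of_notMem hub]
      omega
    have hu1 : nbrsIn G S u = {c} := Finset.eq_singleton_iff_unique_mem.2
      ⟨hcu, fun a ha => Finset.card_le_one.1 hle a ha c hcu⟩
    have hcs : c ≠ s := fun e => he.nbrsIn_ne hC hK hS u (e ▸ hu1)
    have hct : c ≠ t := fun e => he.swap.nbrsIn_ne hC hK hS u (e ▸ hu1)
    have hcb : c ≠ b := fun e => hub (e ▸ hcu)
    have hvx : G.Adj v x := adj_of_nbrsIn_inter hC hS (u := b)
      (one_lt_card_sdiff 1 hc.ge (by simp [hx])) (by simp [he.nbrsIn_left]) (by simp [hx])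
    have hvu : ¬G.Adj v u := not_adj_of_notMem_nbrsIn hC hS (u := c)
      (one_lt_card_sdiff 1 hc.ge (by simp [hu1])) (by simp [he.nbrsIn_left, hcs, hct, hcb])
      hcu
    have hun : ∀ a ∈ S, a ≠ c → ¬G.Adj u a := fun a ha hac hua =>
      hac (by simpa [hu1] using (mem_nbrsIn.2 ⟨hua, ha⟩ : a ∈ nbrsIn G S u))
    exact hC v s t x u he.mem_s.1 he.swap.mem_s.1 hvx hux.symm he.ne_st
      (hS _ he.mem_s.2 _ he.swap.mem_s.2) (fun h' => hnb x hx s he.mem_s.2 he.ne_sb h'.symm)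
      (fun h' => hnb x hx t he.swap.mem_s.2 he.ne_tb h'.symm) hvu
      (fun h' => hun s he.mem_s.2 hcs.symm h'.symm)
      (fun h' => hun t he.swap.mem_s.2 hct.symm h'.symm)

end MinCounterexample
end

section
open scoped Classical

namespace MinCounterexample
variable {V : Type*} [Fintype V] {G : SimpleGraph V} {d w k : ℕ}

/-- A minimal counterexample is claw-free. -/
theorem claw_free (h : MinCounterexample G d w k) {v₀ a₀ b₀ c₀ : V} (ha : G.Adj v₀ a₀)
    (hb : G.Adj v₀ b₀) (hc : G.Adj v₀ c₀) (hab : a₀ ≠ b₀) (hac : a₀ ≠ c₀) (hbc : b₀ ≠ c₀)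
    (hab' : ¬G.Adj a₀ b₀) (hac' : ¬G.Adj a₀ c₀) (hbc' : ¬G.Adj b₀ c₀) : False := by
  have hC := h.chairFree
  have hK := h.kiteFree
  have hst : StableOn G {a₀, b₀, c₀} := by
    intro x hx y hy
    simp only [Finset.mem_insert, Finset.mem_singleton] at hx hy
    rcases hx with rfl | rfl | rfl <;> rcases hy with rfl | rfl | rfl <;>
      simp [hab', hac', hbc', mt Adj.symm hab', mt Adj.symm hac', mt Adj.symm hbc']
  obtain ⟨S, hsub, -, hS, hmax⟩ := hst.exists_maximal (Finset.subset_univ _)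
  simp only [Finset.insert_subset_iff, Finset.singleton_subset_iff] at hsub
  replace hmax : ∀ x, x ∉ S → (nbrsIn G S x).Nonempty := fun x hx => by
    obtain ⟨y, hy, hxy⟩ := hmax x (Finset.mem_univ x) hx
    exact ⟨y, mem_nbrsIn.2 ⟨hxy, hy⟩⟩
  have hv₀S : v₀ ∉ S := fun hv => hS _ hv _ hsub.1 ha
  have hv₀ : 3 ≤ (nbrsIn G S v₀).card := by
    have : ({a₀, b₀, c₀} : Finset V) ⊆ nbrsIn G S v₀ := by
      simp [Finset.insert_subset_iff, hsub, ha, hb, hc]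
    have h3 := Finset.card_le_card this
    rwa [Finset.card_eq_three.2 ⟨a₀, b₀, c₀, hab, hac, hbc, rfl⟩] at h3
  obtain ⟨y, hyS, hy⟩ : ∃ y, y ∉ S ∧ (nbrsIn G S y).card < 2 := by
    by_contra! hcon
    have := h.two_le_clique ha
    have := h.bound_eq
    exact h.reduce ⟨a₀, hsub.1⟩ (by omega) hS.colorableOn fun z hz => hcon z hz
  obtain ⟨s₀, hs₀⟩ := hmax y hyS
  replace hy : nbrsIn G S y = {s₀} := Finset.eq_singleton_iff_unique_mem.2
    ⟨hs₀, fun a ha => Finset.card_le_one.1 (by omega) a ha _ hs₀⟩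
  rw [mem_nbrsIn] at hs₀
  let R : V → V → Prop := fun s t => s ∈ S ∧ t ∈ S ∧ ((∃ x, nbrsIn G S x = {s, t}) ∨
    ∃ x x', G.Adj x x' ∧ nbrsIn G S x = {s} ∧ nbrsIn G S x' = {t})
  have hRsymm : ∀ s t, R s t → R t s := by
    rintro s t ⟨hs, ht, ⟨x, hx⟩ | ⟨x, x', hxx, hx, hx'⟩⟩
    · exact ⟨ht, hs, .inl ⟨x, hx.trans (Finset.pair_comm _ _)⟩⟩
    · exact ⟨ht, hs, .inr ⟨x', x, hxx.symm, hx', hx⟩⟩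
  have hbig : ∀ v, 3 ≤ (nbrsIn G S v).card → ∀ s t, R s t → s ∈ nbrsIn G S v →
      t ∈ nbrsIn G S v := by
    rintro v hv s t ⟨hsS, htS, ⟨x, hx⟩ | ⟨x, x', hxx, hx, hx'⟩⟩ hs <;> by_contra ht
    · refine ht (nbrsIn_subset_of_inter hC hS ?_ hs (x := x) (by simp [hx]) (by simp [hx]))
      have : nbrsIn G S v \ nbrsIn G S x = nbrsIn G S v \ {s} := by
        ext a
        simp only [hx, Finset.mem_sdiff, Finset.mem_insert, Finset.mem_singleton, not_or]
        exact ⟨fun h' => ⟨h'.1, h'.2.1⟩, fun h' => ⟨h'.1, h'.2, fun e => ht (e ▸ h'.1)⟩⟩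
      rw [this]
      exact one_lt_card_sdiff 1 hv (by simp)
    · have h1 : 1 < (nbrsIn G S v \ nbrsIn G S x).card :=
        one_lt_card_sdiff 1 hv (by simp [hx])
      have hvx : G.Adj v x := adj_of_nbrsIn_inter hC hS h1 hs (by simp [hx])
      have hvx' : ¬G.Adj v x' := not_adj_of_notMem_nbrsIn hC hS
        (one_lt_card_sdiff 1 hv (by simp [hx'])) ht (by simp [hx'])
      obtain ⟨a, ha, b, hb, hab⟩ := Finset.one_lt_card.1 h1
      simp only [Finset.mem_sdiff, mem_nbrsIn, not_and] at ha hb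
      have hn : ∀ a, G.Adj v a ∧ a ∈ S → ¬G.Adj a x' := fun a ha hax => ht (by
        have : a ∈ nbrsIn G S x' := mem_nbrsIn.2 ⟨hax.symm, ha.2⟩
        rw [hx', Finset.mem_singleton] at this
        exact this ▸ mem_nbrsIn.2 ha)
      exact hC v a b x x' ha.1.1 hb.1.1 hvx hxx hab (hS _ ha.1.2 _ hb.1.2)
        (fun e => ha.2 e.symm ha.1.2) (fun e => hb.2 e.symm hb.1.2) hvx' (hn a ha.1) (hn b hb.1)
  obtain ⟨C, hCmem⟩ : ∃ C : Finset V, ∀ t, t ∈ C ↔ Relation.ReflTransGen R s₀ t :=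
    ⟨Finset.univ.filter fun t => Relation.ReflTransGen R s₀ t, by simp⟩
  have hCS : ∀ t ∈ C, t ∈ S := by
    intro t ht
    induction (hCmem t).1 ht with
    | refl => exact hs₀.2
    | tail _ hbc _ => exact hbc.2.1
  have hCstep : ∀ s ∈ C, ∀ t, R s t → t ∈ C := fun s hs t hst =>
    (hCmem t).2 (((hCmem s).1 hs).tail hst)
  have hs₀C : s₀ ∈ C := (hCmem s₀).2 .refl
  have hbigC : ∀ v, 3 ≤ (nbrsIn G S v).card → ∀ t ∈ C,
      (s₀ ∈ nbrsIn G S v ↔ t ∈ nbrsIn G S v) := by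
    intro v hv t ht
    induction (hCmem t).1 ht with
    | refl => rfl
    | tail hb hbc ih =>
      exact (ih ((hCmem _).2 hb)).trans ⟨hbig v hv _ _ hbc, hbig v hv _ _ (hRsymm _ _ hbc)⟩
  by_cases hex : ∃ v z, (nbrsIn G S v).card = 3 ∧ (nbrsIn G S z).card = 2 ∧
      nbrsIn G S z ⊆ C ∧ C ⊆ nbrsIn G S v ∧ ¬G.Adj v z
  · obtain ⟨v, z, hv, hz, hzC, hCv, hvz⟩ := hex
    obtain ⟨s, t, hstne, hzst⟩ := Finset.card_eq_two.1 hz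
    obtain ⟨b, hb⟩ := Finset.card_eq_one.1 (show (nbrsIn G S v \ nbrsIn G S z).card = 1 by
      rw [Finset.card_sdiff_of_subset (hzC.trans hCv)]
      omega)
    have hbz : b ∉ nbrsIn G S z := (Finset.mem_sdiff.1
      (by rw [hb]; simp : b ∈ nbrsIn G S v \ nbrsIn G S z)).2
    rw [hzst, Finset.mem_insert, Finset.mem_singleton, not_or] at hbz
    have he : ExceptionalPair G S v z s t b :=
      ⟨by rw [← Finset.sdiff_union_of_subset (hzC.trans hCv), hb, hzst]; ext; simp; tauto, hzst,
        hvz, hstne, Ne.symm hbz.1, Ne.symm hbz.2⟩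
    have hs₀v := hCv hs₀C
    rw [he.nbrsIn_left, Finset.mem_insert, Finset.mem_insert, Finset.mem_singleton] at hs₀v
    rcases hs₀v with rfl | rfl | rfl
    · exact he.nbrsIn_ne hC hK hS y hy
    · exact he.swap.nbrsIn_ne hC hK hS y hy
    · exact h.nbrsIn_ne_of_exceptionalPair hS hmax he hyS hy
  obtain ⟨M, hM⟩ : ∃ M : Finset V, ∀ x, x ∈ M ↔ x ∈ C ∨
      (x ∉ S ∧ (nbrsIn G S x).card ≤ 2 ∧ nbrsIn G S x ⊆ C) :=
    ⟨Finset.univ.filter fun x => x ∈ C ∨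
      (x ∉ S ∧ (nbrsIn G S x).card ≤ 2 ∧ nbrsIn G S x ⊆ C), by simp⟩
  refine h.not_module' (M := M) (fun z hz => ?_) ((hM s₀).2 (.inl hs₀C))
    ((hM y).2 (.inr ⟨hyS, by simp [hy], by simpa [hy] using hs₀C⟩)) hs₀.1.symm (x₂ := v₀)
    fun hv => ((hM v₀).1 hv).elim (fun h' => hv₀S (hCS _ h')) fun h' => by omega
  rw [hM, not_or] at hz
  by_cases hzS : z ∈ S
  · refine .inl fun x hx hzx => ?_
    rcases (hM x).1 hx with hx | ⟨-, -, hx⟩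
    · exact hS _ hzS _ (hCS _ hx) hzx
    · exact hz.1 (hx (mem_nbrsIn.2 ⟨hzx.symm, hzS⟩))
  by_cases hzb : 3 ≤ (nbrsIn G S z).card
  · by_cases hs₀z : s₀ ∈ nbrsIn G S z
    · have hCz : C ⊆ nbrsIn G S z := fun t ht => (hbigC z hzb t ht).1 hs₀z
      refine .inr fun x hx => ?_
      rcases (hM x).1 hx with hx | ⟨hxS, hx2, hxC⟩
      · exact (mem_nbrsIn.1 (hCz hx)).1
      obtain ⟨u, hu⟩ := hmax x hxS
      by_contra hzx
      by_cases hlt : 1 < (nbrsIn G S z \ nbrsIn G S x).card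
      · exact hzx (adj_of_nbrsIn_inter hC hS hlt (hCz (hxC hu)) hu)
      · rw [Finset.card_sdiff_of_subset (hxC.trans hCz)] at hlt
        exact hex ⟨z, x, by omega, by omega, hxC, hCz, hzx⟩
    · have hCz : ∀ t ∈ C, t ∉ nbrsIn G S z := fun t ht h' => hs₀z ((hbigC z hzb t ht).2 h')
      refine .inl fun x hx => ?_
      rcases (hM x).1 hx with hx | ⟨hxS, hx2, hxC⟩
      · exact fun h' => hCz x hx (mem_nbrsIn.2 ⟨h', hCS _ hx⟩)
      obtain ⟨u, hu⟩ := hmax x hxS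
      refine not_adj_of_notMem_nbrsIn hC hS ?_ (hCz u (hxC hu)) hu
      rw [Finset.sdiff_eq_self_of_disjoint]
      · omega
      · exact Finset.disjoint_left.2 fun a ha ha' => hCz a (hxC ha') ha
  · have hdisj : ∀ s ∈ nbrsIn G S z, s ∉ C := by
      intro s hs hsC
      refine hz.2 ⟨hzS, by omega, fun t ht => ?_⟩
      by_cases hts : t = s
      · exact hts ▸ hsC
      refine hCstep s hsC t ⟨(mem_nbrsIn.1 hs).2, (mem_nbrsIn.1 ht).2, .inl ⟨z, ?_⟩⟩
      refine (Finset.eq_of_subset_of_card_le (Finset.insert_subset hs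
        (Finset.singleton_subset_iff.2 ht)) ?_).symm
      rw [Finset.card_pair (Ne.symm hts)]
      omega
    refine .inl fun x hx hzx => ?_
    rcases (hM x).1 hx with hx | ⟨hxS, hx2, hxC⟩
    · exact hdisj x (mem_nbrsIn.2 ⟨hzx, hCS _ hx⟩) hx
    obtain ⟨s, hs⟩ := hmax x hxS
    obtain ⟨t, ht⟩ := hmax z hzS
    have hd : Disjoint (nbrsIn G S x) (nbrsIn G S z) :=
      Finset.disjoint_left.2 fun a ha ha' => hdisj a ha' (hxC ha)
    have h1 : (nbrsIn G S x).card ≤ 1 := by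
      by_contra hlt
      refine hdisj t ht (hxC (nbrsIn_subset_of_adj hC hS hzx.symm ?_ ht))
      rw [Finset.sdiff_eq_self_of_disjoint hd]
      omega
    have h2 : (nbrsIn G S z).card ≤ 1 := by
      by_contra hlt
      refine hdisj s (nbrsIn_subset_of_adj hC hS hzx ?_ hs) (hxC hs)
      rw [Finset.sdiff_eq_self_of_disjoint hd.symm]
      omega
    refine hdisj t ht (hCstep s (hxC hs) t
      ⟨(mem_nbrsIn.1 hs).2, (mem_nbrsIn.1 ht).2, .inr ⟨x, z, hzx.symm, ?_, ?_⟩⟩)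
    · exact Finset.eq_singleton_iff_unique_mem.2
        ⟨hs, fun a ha => Finset.card_le_one.1 h1 a ha _ hs⟩
    · exact Finset.eq_singleton_iff_unique_mem.2
        ⟨ht, fun a ha => Finset.card_le_one.1 h2 a ha _ ht⟩

end MinCounterexample
end

section
open scoped Classical

/-- `p, q, a, b` induce a diamond whose missing edge is `ab`. -/
structure IsDiamond {V : Type*} (G : SimpleGraph V) (p q a b : V) : Prop where
  pq : G.Adj p q
  pa : G.Adj p a
  pb : G.Adj p b
  qa : G.Adj q a
  qb : G.Adj q b
  ne : a ≠ b
  not_adj : ¬G.Adj a b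

namespace IsDiamond
variable {V : Type*} {G : SimpleGraph V} {p q a b : V}

theorem swap_left (hD : IsDiamond G p q a b) : IsDiamond G q p a b :=
  ⟨hD.pq.symm, hD.qa, hD.qb, hD.pa, hD.pb, hD.ne, hD.not_adj⟩

theorem swap_right (hD : IsDiamond G p q a b) : IsDiamond G p q b a :=
  ⟨hD.pq, hD.pb, hD.pa, hD.qb, hD.qa, hD.ne.symm, fun h => hD.not_adj h.symm⟩

end IsDiamond

namespace MinCounterexample
variable {V : Type*} [Fintype V] {G : SimpleGraph V} {d w k : ℕ} {p q a b : V}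

theorem claw_free' (h : MinCounterexample G d w k) {v a b c : V} (ha : G.Adj v a)
    (hb : G.Adj v b) (hc : G.Adj v c) (hab : a ≠ b) (hac : a ≠ c) (hbc : b ≠ c) :
    G.Adj a b ∨ G.Adj a c ∨ G.Adj b c := by
  by_contra! hcon
  exact h.claw_free ha hb hc hab hac hbc hcon.1 hcon.2.1 hcon.2.2

/-- In a claw- and kite-free graph no vertex is at distance two from a diamond. -/
theorem not_dist_two_diamond (h : MinCounterexample G d w k) (hD : IsDiamond G p q a b) {u c : V}
    (huc : G.Adj u c) (hp : ¬G.Adj c p) (hq : ¬G.Adj c q) (ha : ¬G.Adj c a) (hb : ¬G.Adj c b)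
    (hub : ¬G.Adj u b) (hu : G.Adj u a ∨ G.Adj u p ∨ G.Adj u q) : False := by
  have hab := hD.not_adj
  have hua' : u ≠ a := by rintro rfl; exact ha huc.symm
  have hub' : u ≠ b := by rintro rfl; exact hb huc.symm
  by_cases hua : G.Adj u a
  · by_cases hup : G.Adj u p <;> by_cases huq : G.Adj u q
    · exact h.kiteFree p q u b c hD.pq hup.symm hD.pb huq.symm hD.qb huc hub hp hq hb
    · exact h.kiteFree a p u q c hD.pa.symm hua.symm hD.qa.symm hup.symm hD.pq huc huq ha hp hq
    · exact h.kiteFree a q u p c hD.qa.symm hua.symm hD.pa.symm huq.symm hD.pq.symm huc hup ha hq hp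
    · exact h.kiteFree p q a b u hD.pq hD.pa hD.pb hD.qa hD.qb hua.symm hab hup huq hub
  · rcases hu with hu | hu | hu
    · exact hua hu
    · exact h.claw_free hD.pa hD.pb hu.symm hD.ne hua'.symm hub'.symm hab
        (fun e => hua e.symm) fun e => hub e.symm
    · exact h.claw_free hD.qa hD.qb hu.symm hD.ne hua'.symm hub'.symm hab
        (fun e => hua e.symm) fun e => hub e.symm

/-- The two nonadjacent vertices of a diamond dominate the graph. -/
theorem adj_of_diamond (h : MinCounterexample G d w k) (hD : IsDiamond G p q a b) (x : V)
    (hxa : x ≠ a) (hxb : x ≠ b) : G.Adj x a ∨ G.Adj x b := by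
  have hdom : ∀ x, G.Adj x a ∨ G.Adj x b ∨ G.Adj x p ∨ G.Adj x q := by
    by_contra! hcon
    obtain ⟨z, hz⟩ := hcon
    obtain ⟨u, hu, c, hc, huc⟩ := h.exists_adj_compl
      (s := Finset.univ.filter fun x => G.Adj x a ∨ G.Adj x b ∨ G.Adj x p ∨ G.Adj x q)
      ⟨p, by simp [hD.pa]⟩ (fun hu => by
        have := (Finset.ext_iff.1 hu z).2 (Finset.mem_univ z)
        simp only [Finset.mem_filter, Finset.mem_univ, true_and] at this
        tauto)
    simp only [Finset.mem_filter, Finset.mem_univ, true_and, not_or] at hu hc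
    by_cases hub : G.Adj u b
    · by_cases hua : G.Adj u a
      · refine h.claw_free hua hub huc hD.ne ?_ ?_ hD.not_adj (fun e => hc.1 e.symm)
          fun e => hc.2.1 e.symm
        · rintro rfl
          exact hc.2.2.1 hD.pa.symm
        · rintro rfl
          exact hc.2.2.1 hD.pb.symm
      · exact h.not_dist_two_diamond hD.swap_right huc hc.2.2.1 hc.2.2.2 hc.2.1 hc.1 hua
          (.inl hub)
    · exact h.not_dist_two_diamond hD huc hc.2.2.1 hc.2.2.2 hc.1 hc.2.1 hub (by tauto)
  by_contra! hcon
  rcases hdom x with hx | hx | hx | hx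
  · exact hcon.1 hx
  · exact hcon.2 hx
  · exact h.claw_free hD.pa hD.pb hx.symm hD.ne hxa.symm hxb.symm hD.not_adj
      (fun e => hcon.1 e.symm) fun e => hcon.2 e.symm
  · exact h.claw_free hD.qa hD.qb hx.symm hD.ne hxa.symm hxb.symm hD.not_adj
      (fun e => hcon.1 e.symm) fun e => hcon.2 e.symm

theorem not_sun (h : MinCounterexample G d w k) {t₁ t₂ t₃ s₁ s₂ s₃ : V} (h₁₂ : G.Adj t₁ t₂)
    (h₁₃ : G.Adj t₁ t₃) (h₂₃ : G.Adj t₂ t₃) (a₁₂ : G.Adj s₁ t₂) (a₁₃ : G.Adj s₁ t₃)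
    (a₂₁ : G.Adj s₂ t₁) (a₂₃ : G.Adj s₂ t₃) (a₃₁ : G.Adj s₃ t₁) (a₃₂ : G.Adj s₃ t₂)
    (n₂ : ¬G.Adj s₂ t₂) (n₃ : ¬G.Adj s₃ t₃) (m₁₂ : ¬G.Adj s₁ s₂)
    (m₁₃ : ¬G.Adj s₁ s₃) (m₂₃ : ¬G.Adj s₂ s₃) : False := by
  have d₁₂ : s₁ ≠ s₂ := fun e => n₂ (e ▸ a₁₂)
  have d₁₃ : s₁ ≠ s₃ := fun e => n₃ (e ▸ a₁₃)
  have d₂₃ : s₂ ≠ s₃ := fun e => n₂ (e ▸ a₃₂)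
  have e₂ : s₂ ≠ t₂ := fun e => m₁₂ (e ▸ a₁₂)
  have e₃ : s₃ ≠ t₃ := fun e => m₁₃ (e ▸ a₁₃)
  have key : ∀ x, G.Adj s₁ x → x = t₂ ∨ x = t₃ ∨ (G.Adj x t₂ ∧ G.Adj x t₃ ∧ ¬G.Adj x s₃) := by
    intro x hx
    by_cases hx₂ : x = t₂
    · exact .inl hx₂
    by_cases hx₃ : x = t₃
    · exact .inr (.inl hx₃)
    have hxs₂ : x ≠ s₂ := by rintro rfl; exact m₁₂ hx
    have hxs₃ : x ≠ s₃ := by rintro rfl; exact m₁₃ hx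
    have hA := h.adj_of_diamond ⟨h₁₂, a₃₁.symm, h₁₃, a₃₂.symm, h₂₃, e₃, n₃⟩ x hxs₃ hx₃
    have hB := h.adj_of_diamond ⟨h₁₃, a₂₁.symm, h₁₂, a₂₃.symm, h₂₃.symm, e₂, n₂⟩ x hxs₂ hx₂
    by_cases hs₂ : G.Adj x s₂
    · by_cases hs₃ : G.Adj x s₃
      · exact (h.claw_free hx.symm hs₂ hs₃ d₁₂ d₁₃ d₂₃ m₁₂ m₁₃ m₂₃).elim
      · have hxt := hA.resolve_left hs₃
        rcases h.adj_of_diamond ⟨hxt, hx.symm, hs₂, a₁₃.symm, a₂₃.symm, d₁₂, m₁₂⟩ s₃ d₁₃.symm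
          d₂₃.symm with e | e
        · exact (m₁₃ e.symm).elim
        · exact (m₂₃ e.symm).elim
    · have hxt := hB.resolve_left hs₂
      by_cases hs₃ : G.Adj x s₃
      · rcases h.adj_of_diamond ⟨hxt, hx.symm, hs₃, a₁₂.symm, a₃₂.symm, d₁₃, m₁₃⟩ s₂ d₁₂.symm
          d₂₃ with e | e
        · exact (m₁₂ e.symm).elim
        · exact (m₂₃ e).elim
      · exact .inr (.inr ⟨hxt, hA.resolve_left hs₃, hs₃⟩)
  refine h.not_simplicial s₁ fun x hx y hy hxy => ?_
  rw [mem_nbrs] at hx hy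
  rcases key x hx with rfl | rfl | hxs <;> rcases key y hy with rfl | rfl | hyt
  · exact absurd rfl hxy
  · exact h₂₃
  · exact hyt.1.symm
  · exact h₂₃.symm
  · exact absurd rfl hxy
  · exact hyt.2.1.symm
  · exact hxs.1
  · exact hxs.2.1
  · by_contra hcon
    exact h.claw_free hxs.1.symm hyt.1.symm a₃₂.symm hxy (fun e => m₁₃ (e ▸ hx))
      (fun e => m₁₃ (e ▸ hy)) hcon hxs.2.2 hyt.2.2

/-- Three distinct pairwise nonadjacent vertices. -/
structure StableTriple (G : SimpleGraph V) (c₁ c₂ c₃ : V) : Prop where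
  ne₁₂ : c₁ ≠ c₂
  ne₁₃ : c₁ ≠ c₃
  ne₂₃ : c₂ ≠ c₃
  not₁₂ : ¬G.Adj c₁ c₂
  not₁₃ : ¬G.Adj c₁ c₃
  not₂₃ : ¬G.Adj c₂ c₃

variable {c₁ c₂ c₃ : V}

omit [Fintype V] in
theorem StableTriple.swap₁₂ (hT : StableTriple G c₁ c₂ c₃) : StableTriple G c₂ c₁ c₃ :=
  ⟨hT.ne₁₂.symm, hT.ne₂₃, hT.ne₁₃, fun e => hT.not₁₂ e.symm, hT.not₂₃, hT.not₁₃⟩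

omit [Fintype V] in
theorem StableTriple.swap₂₃ (hT : StableTriple G c₁ c₂ c₃) : StableTriple G c₁ c₃ c₂ :=
  ⟨hT.ne₁₃, hT.ne₁₂, hT.ne₂₃.symm, hT.not₁₃, hT.not₁₂, fun e => hT.not₂₃ e.symm⟩

/-- Two vertices of a stable triple lie in no diamond as its nonadjacent pair. -/
theorem not_diamond_of_stableTriple (h : MinCounterexample G d w k)
    (hT : StableTriple G c₁ c₂ c₃) : ¬IsDiamond G p q c₁ c₂ := fun hD =>
  (h.adj_of_diamond hD c₃ hT.ne₁₃.symm hT.ne₂₃.symm).elim (fun e => hT.not₁₃ e.symm)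
    fun e => hT.not₂₃ e.symm

theorem not_diamond_of_mem (h : MinCounterexample G d w k) (hD : IsDiamond G p q a b)
    (hT : StableTriple G a c₂ c₃) : False := by
  have hb₂ : c₂ ≠ b := by
    rintro rfl
    exact h.not_diamond_of_stableTriple hT hD
  have hb₃ : c₃ ≠ b := by
    rintro rfl
    exact h.not_diamond_of_stableTriple hT.swap₂₃ hD
  have h₂ : G.Adj c₂ b := (h.adj_of_diamond hD c₂ hT.ne₁₂.symm hb₂).resolve_left
    fun e => hT.not₁₂ e.symm
  have h₃ : G.Adj c₃ b := (h.adj_of_diamond hD c₃ hT.ne₁₃.symm hb₃).resolve_left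
    fun e => hT.not₁₃ e.symm
  have hone : ∀ p, G.Adj p a → G.Adj p b → (G.Adj p c₂ ∧ ¬G.Adj p c₃) ∨
      (G.Adj p c₃ ∧ ¬G.Adj p c₂) := by
    intro p hpa hpb
    have hp₂ : p ≠ c₂ := by
      rintro rfl
      exact hT.not₁₂ hpa.symm
    have hp₃ : p ≠ c₃ := by
      rintro rfl
      exact hT.not₁₃ hpa.symm
    have hnot : ¬(G.Adj p c₂ ∧ G.Adj p c₃) := fun e =>
      h.claw_free hpa e.1 e.2 hT.ne₁₂ hT.ne₁₃ hT.ne₂₃ hT.not₁₂ hT.not₁₃ hT.not₂₃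
    have := h.claw_free' h₂.symm h₃.symm hpb.symm hT.ne₂₃ hp₂.symm hp₃.symm
    rw [G.adj_comm c₂ p, G.adj_comm c₃ p] at this
    have := hT.not₂₃
    tauto
  have n₁₂ := hT.not₁₂
  have n₁₃ := hT.not₁₃
  rcases hone p hD.pa hD.pb with ⟨hp₂, hp₃⟩ | ⟨hp₃, hp₂⟩ <;>
    rcases hone q hD.qa hD.qb with ⟨hq₂, hq₃⟩ | ⟨hq₃, hq₂⟩
  · exact h.not_diamond_of_stableTriple hT ⟨hD.pq, hD.pa, hp₂, hD.qa, hq₂, hT.ne₁₂, n₁₂⟩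
  · exact h.not_sun (t₁ := b) (t₂ := q) (t₃ := p) (s₁ := a) (s₂ := c₂) (s₃ := c₃) hD.qb.symm
      hD.pb.symm hD.pq.symm hD.qa.symm hD.pa.symm h₂ hp₂.symm h₃ hq₃.symm (fun e => hq₂ e.symm)
      (fun e => hp₃ e.symm) n₁₂ n₁₃ hT.not₂₃
  · exact h.not_sun (t₁ := b) (t₂ := p) (t₃ := q) (s₁ := a) (s₂ := c₂) (s₃ := c₃) hD.pb.symm
      hD.qb.symm hD.pq hD.pa.symm hD.qa.symm h₂ hq₂.symm h₃ hp₃.symm (fun e => hp₂ e.symm)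
      (fun e => hq₃ e.symm) n₁₂ n₁₃ hT.not₂₃
  · exact h.not_diamond_of_stableTriple hT.swap₂₃ ⟨hD.pq, hD.pa, hp₃, hD.qa, hq₃, hT.ne₁₃, n₁₃⟩

theorem not_diamond_of_adj (h : MinCounterexample G d w k) (hD : IsDiamond G p q a b)
    (hT : StableTriple G c₁ c₂ c₃) (h₃ : ¬G.Adj c₃ a) (h₃' : G.Adj c₃ b)
    (h₁ : G.Adj c₁ a) (h₂ : G.Adj c₂ a) (h₁' : ¬G.Adj c₁ b) (hp : G.Adj c₁ p) : False := by
  have h₂p : ¬G.Adj c₂ p := fun e => h.not_diamond_of_stableTriple hT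
    ⟨hD.pa.symm, h₁.symm, h₂.symm, hp.symm, e.symm, hT.ne₁₂, hT.not₁₂⟩
  have h₁₂q : ¬(G.Adj c₁ q ∧ G.Adj c₂ q) := fun e => h.not_diamond_of_stableTriple hT
    ⟨hD.qa.symm, h₁.symm, h₂.symm, e.1.symm, e.2.symm, hT.ne₁₂, hT.not₁₂⟩
  have hqc₁ : q ≠ c₁ := by
    rintro rfl
    exact h₁' hD.qb
  have hqc₃ : q ≠ c₃ := by
    rintro rfl
    exact h₃ hD.qa
  have hpc₃ : p ≠ c₃ := by
    rintro rfl
    exact h₃ hD.pa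
  have hpc₂ : p ≠ c₂ := by
    rintro rfl
    exact hT.not₁₂ hp
  have hq₃ : ¬G.Adj c₁ q → G.Adj c₃ q := fun e =>
    (h.adj_of_diamond (p := a) (q := p) (a := c₁) (b := q)
      ⟨hD.pa.symm, h₁.symm, hD.qa.symm, hp.symm, hD.pq, hqc₁.symm, e⟩ c₃ hT.ne₁₃.symm
      hqc₃.symm).resolve_left fun e => hT.not₁₃ e.symm
  by_cases h₂' : G.Adj c₂ b
  · have h₂q : ¬G.Adj c₂ q := fun e => h.not_diamond_of_stableTriple hT.swap₁₂.swap₂₃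
      ⟨hD.qb.symm, h₂'.symm, h₃'.symm, e.symm, (hq₃ fun e' => h₁₂q ⟨e', e⟩).symm, hT.ne₂₃,
        hT.not₂₃⟩
    have hqc₂ : q ≠ c₂ := by
      rintro rfl
      exact h₂p hD.pq.symm
    have h₁q : G.Adj c₁ q := by
      rcases h.claw_free' h₁.symm h₂.symm hD.qa.symm hT.ne₁₂ hqc₁.symm hqc₂.symm with e | e | e
      · exact (hT.not₁₂ e).elim
      · exact e
      · exact (h₂q e).elim
    have h₃p : G.Adj c₃ p := by
      rcases h.claw_free' h₂'.symm h₃'.symm hD.pb.symm hT.ne₂₃ hpc₂.symm hpc₃.symm with e | e | e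
      · exact (hT.not₂₃ e).elim
      · exact (h₂p e).elim
      · exact e
    have h₃q : G.Adj c₃ q := by
      rcases h.claw_free' h₂'.symm h₃'.symm hD.qb.symm hT.ne₂₃ hqc₂.symm hqc₃.symm with e | e | e
      · exact (hT.not₂₃ e).elim
      · exact (h₂q e).elim
      · exact e
    exact h.not_diamond_of_stableTriple hT.swap₂₃
      ⟨hD.pq, hp.symm, h₃p.symm, h₁q.symm, h₃q.symm, hT.ne₁₃, hT.not₁₃⟩
  · have h₂q : G.Adj c₂ q := by
      by_contra e
      exact h.kiteFree p q a b c₂ hD.pq hD.pa hD.pb hD.qa hD.qb h₂.symm hD.not_adj h₂p e h₂'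
    have h₁q : ¬G.Adj c₁ q := fun e => h₁₂q ⟨e, h₂q⟩
    have h₃p : G.Adj c₃ p := (h.adj_of_diamond (p := a) (q := q) (a := c₂) (b := p)
      ⟨hD.qa.symm, h₂.symm, hD.pa.symm, h₂q.symm, hD.pq.symm, hpc₂.symm, h₂p⟩ c₃ hT.ne₂₃.symm
      hpc₃.symm).resolve_left fun e => hT.not₂₃ e.symm
    exact h.not_sun (t₁ := q) (t₂ := p) (t₃ := a) (s₁ := c₁) (s₂ := c₂) (s₃ := c₃) hD.pq.symm
      hD.qa hD.pa hp h₁ h₂q h₂ (hq₃ h₁q) h₃p h₂p h₃ hT.not₁₂ hT.not₁₃ hT.not₂₃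

theorem not_diamond_of_adj_adj (h : MinCounterexample G d w k) (hD : IsDiamond G p q a b)
    (hT : StableTriple G c₁ c₂ c₃) (ha : c₃ ≠ a) (hb : c₃ ≠ b) (h₁ : G.Adj c₁ a)
    (h₂ : G.Adj c₂ a) : False := by
  have h₃ : ¬G.Adj c₃ a := fun e => h.claw_free h₁.symm h₂.symm e.symm hT.ne₁₂ hT.ne₁₃ hT.ne₂₃
    hT.not₁₂ hT.not₁₃ hT.not₂₃
  have h₃' : G.Adj c₃ b := (h.adj_of_diamond hD c₃ ha hb).resolve_left h₃
  have key : ∀ c₁ c₂, StableTriple G c₁ c₂ c₃ → G.Adj c₁ a → G.Adj c₂ a → ¬G.Adj c₁ b → False := by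
    intro c₁ c₂ hT h₁ h₂ h₁'
    by_cases hp : G.Adj c₁ p
    · exact h.not_diamond_of_adj hD hT h₃ h₃' h₁ h₂ h₁' hp
    by_cases hq : G.Adj c₁ q
    · exact h.not_diamond_of_adj hD.swap_left hT h₃ h₃' h₁ h₂ h₁' hq
    exact h.kiteFree p q a b c₁ hD.pq hD.pa hD.pb hD.qa hD.qb h₁.symm hD.not_adj hp hq h₁'
  by_cases hcb : G.Adj c₁ b
  · refine key c₂ c₁ hT.swap₁₂ h₂ h₁ fun h₂' => ?_
    exact h.claw_free hcb.symm h₂'.symm h₃'.symm hT.ne₁₂ hT.ne₁₃ hT.ne₂₃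
      hT.not₁₂ hT.not₁₃ hT.not₂₃
  · exact key c₁ c₂ hT h₁ h₂ hcb

/-- A minimal counterexample has no induced diamond. -/
theorem not_isDiamond (h : MinCounterexample G d w k) : ¬IsDiamond G p q a b := by
  intro hD
  have hT := h.not_noThreeStable
  simp only [NoThreeStable, not_forall] at hT
  obtain ⟨c₁, -, c₂, -, c₃, -, h₁₂, h₁₃, h₂₃, n₁₂, n₁₃, n₂₃⟩ := hT
  have hT : StableTriple G c₁ c₂ c₃ := ⟨h₁₂, h₁₃, h₂₃, n₁₂, n₁₃, n₂₃⟩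
  have hne : ∀ c₁ c₂ c₃, StableTriple G c₁ c₂ c₃ → c₁ ≠ a ∧ c₁ ≠ b := by
    intro c₁ c₂ c₃ hT
    constructor
    · rintro rfl
      exact h.not_diamond_of_mem hD hT
    · rintro rfl
      exact h.not_diamond_of_mem hD.swap_right hT
  obtain ⟨ha₁, hb₁⟩ := hne _ _ _ hT
  obtain ⟨ha₂, hb₂⟩ := hne _ _ _ hT.swap₁₂
  obtain ⟨ha₃, hb₃⟩ := hne _ _ _ hT.swap₂₃.swap₁₂
  have hT₁₃ := hT.swap₂₃
  have hT₂₃ := hT.swap₁₂.swap₂₃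
  rcases h.adj_of_diamond hD c₁ ha₁ hb₁ with h₁ | h₁ <;>
    rcases h.adj_of_diamond hD c₂ ha₂ hb₂ with h₂ | h₂ <;>
    rcases h.adj_of_diamond hD c₃ ha₃ hb₃ with h₃ | h₃
  · exact h.not_diamond_of_adj_adj hD hT ha₃ hb₃ h₁ h₂
  · exact h.not_diamond_of_adj_adj hD hT ha₃ hb₃ h₁ h₂
  · exact h.not_diamond_of_adj_adj hD hT₁₃ ha₂ hb₂ h₁ h₃
  · exact h.not_diamond_of_adj_adj hD.swap_right hT₂₃ hb₁ ha₁ h₂ h₃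
  · exact h.not_diamond_of_adj_adj hD hT₂₃ ha₁ hb₁ h₂ h₃
  · exact h.not_diamond_of_adj_adj hD.swap_right hT₁₃ hb₂ ha₂ h₁ h₃
  · exact h.not_diamond_of_adj_adj hD.swap_right hT hb₃ ha₃ h₁ h₂
  · exact h.not_diamond_of_adj_adj hD.swap_right hT hb₃ ha₃ h₁ h₂

end MinCounterexample
end

section
open scoped Classical

/-- The edges of `G - x` joining a vertex of colour `i` to a vertex of colour `j`. -/
def bicoloured {V : Type*} (G : SimpleGraph V) (x : V) (c : V → ℕ) (i j : ℕ) : SimpleGraph V where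
  Adj u v := G.Adj u v ∧ u ≠ x ∧ v ≠ x ∧ (c u = i ∧ c v = j ∨ c u = j ∧ c v = i)
  symm := ⟨fun _ _ h => ⟨h.1.symm, h.2.2.1, h.2.1, by tauto⟩⟩
  loopless := ⟨fun _ h => G.irrefl h.1⟩

/-- Exchange the colours `i` and `j` on the bicoloured component of `t`. -/
noncomputable def kempe {V : Type*} (G : SimpleGraph V) (x : V) (c : V → ℕ) (i j : ℕ) (t u : V) :
    ℕ :=
  if (bicoloured G x c i j).Reachable t u then Equiv.swap i j (c u) else c u

section Kempe
variable {V : Type*} {G : SimpleGraph V} {x t : V} {c : V → ℕ} {i j k : ℕ}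

theorem kempe_lt (hi : i < k) (hj : j < k) (hk : ∀ u, u ≠ x → c u < k) {u : V} (hu : u ≠ x) :
    kempe G x c i j t u < k := by
  unfold kempe
  split_ifs
  · rw [Equiv.swap_apply_def]
    split_ifs
    · exact hj
    · exact hi
    · exact hk u hu
  · exact hk u hu

theorem kempe_ne (hc : ∀ u, u ≠ x → ∀ v, v ≠ x → G.Adj u v → c u ≠ c v) {u v : V} (hu : u ≠ x)
    (hv : v ≠ x) (huv : G.Adj u v) : kempe G x c i j t u ≠ kempe G x c i j t v := by
  have key : ∀ u v, u ≠ x → v ≠ x → G.Adj u v → (bicoloured G x c i j).Reachable t u →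
      ¬(bicoloured G x c i j).Reachable t v → Equiv.swap i j (c u) ≠ c v := by
    intro u v hu hv huv h1 h2 he
    have hne := hc u hu v hv huv
    refine h2 (h1.trans (Adj.reachable (G := bicoloured G x c i j) ⟨huv, hu, hv, ?_⟩))
    rw [Equiv.swap_apply_def] at he
    split_ifs at he with h3 h4
    · exact .inl ⟨h3, he.symm⟩
    · exact .inr ⟨h4, he.symm⟩
    · exact absurd he hne
  unfold kempe
  split_ifs with h1 h2 h2
  · exact fun he => hc u hu v hv huv ((Equiv.swap i j).injective he)
  · exact key u v hu hv huv h1 h2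
  · exact (key v u hv hu huv.symm h2 h1).symm
  · exact hc u hu v hv huv

theorem eq_of_kempe_eq {l : ℕ} (hi : l ≠ i) (hj : l ≠ j) {u : V}
    (hu : kempe G x c i j t u = l) : c u = l := by
  unfold kempe at hu
  split_ifs at hu
  · rw [Equiv.swap_apply_def] at hu
    split_ifs at hu
    · exact absurd hu.symm hj
    · exact absurd hu.symm hi
    · exact hu
  · exact hu

theorem kempe_eq_right {u : V} (hu : kempe G x c i j t u = j) :
    (bicoloured G x c i j).Reachable t u ∧ c u = i ∨
      ¬(bicoloured G x c i j).Reachable t u ∧ c u = j := by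
  unfold kempe at hu
  split_ifs at hu with h
  · left
    refine ⟨h, (Equiv.swap i j).injective ?_⟩
    rw [hu, Equiv.swap_apply_left]
  · exact .inr ⟨h, hu⟩

end Kempe

namespace MinCounterexample
variable {V : Type*} [Fintype V] {G : SimpleGraph V} {d w k : ℕ}

theorem card_bicoloured_le_two (h : MinCounterexample G d w k) {x : V} {c : V → ℕ} {i j : ℕ}
    (hc : ∀ u, u ≠ x → ∀ v, v ≠ x → G.Adj u v → c u ≠ c v) (u : V) :
    (nbrs (bicoloured G x c i j) u).card ≤ 2 := by
  by_contra! hcon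
  obtain ⟨a, b, e, ha, hb, he, hab, hae, hbe⟩ := Finset.two_lt_card_iff.1 hcon
  rw [mem_nbrs] at ha hb he
  have hcol : c a = c b ∧ c a = c e ∨ i = j := by
    have h1 := ha.2.2.2
    have h2 := hb.2.2.2
    have h3 := he.2.2.2
    omega
  rcases hcol with hcol | hcol
  · rcases h.claw_free' ha.1 hb.1 he.1 hab hae hbe with h1 | h1 | h1
    · exact hc a ha.2.2.1 b hb.2.2.1 h1 hcol.1
    · exact hc a ha.2.2.1 e he.2.2.1 h1 hcol.2
    · exact hc b hb.2.2.1 e he.2.2.1 h1 (hcol.1.symm.trans hcol.2)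
  · have h1 := ha.2.2.2
    exact hc u ha.2.1 a ha.2.2.1 ha.1 (by omega)

theorem card_bicoloured_le_one (h : MinCounterexample G d w k) {x : V} {c : V → ℕ} {i j : ℕ}
    (hc : ∀ u, u ≠ x → ∀ v, v ≠ x → G.Adj u v → c u ≠ c v) {u z : V} (huz : G.Adj u z)
    (hz : ∀ a, (bicoloured G x c i j).Adj u a → a ≠ z ∧ ¬G.Adj a z) :
    (nbrs (bicoloured G x c i j) u).card ≤ 1 := by
  by_contra! hcon
  obtain ⟨a, b, ha, hb, hab⟩ := Finset.one_lt_card_iff.1 hcon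
  rw [mem_nbrs] at ha hb
  have h1 := ha.2.2.2
  have h2 := hb.2.2.2
  have h3 := hc u ha.2.1 a ha.2.2.1 ha.1
  rcases h.claw_free' ha.1 hb.1 huz hab (hz a ha).1 (hz b hb).1 with h4 | h4 | h4
  · exact hc a ha.2.2.1 b hb.2.2.1 h4 (by omega)
  · exact (hz a ha).2 h4
  · exact (hz b hb).2 h4

theorem exists_maximum_clique (h : MinCounterexample G d w k) :
    ∃ Q : Finset V, CliqueOn G Q ∧ 2 ≤ Q.card ∧ ∀ t, CliqueOn G t → t.card ≤ Q.card := by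
  obtain ⟨Q, hQ, hmax⟩ := Finset.exists_max_image
    (Finset.univ.filter fun t => CliqueOn G t) Finset.card
    ⟨∅, Finset.mem_filter.2 ⟨Finset.mem_univ _, by simp [CliqueOn]⟩⟩
  simp only [Finset.mem_filter, Finset.mem_univ, true_and] at hQ hmax
  refine ⟨Q, hQ, ?_, hmax⟩
  obtain ⟨v⟩ := h.nonempty
  have h1 := h.le_card_nbrs v
  have h2 := h.bound_eq
  have h3 := h.card_nbrs_le v
  have h4 := h.card_clique_le {v} (by simp [CliqueOn])
  obtain ⟨u, hu⟩ : (nbrs G v).Nonempty := Finset.card_pos.1 (by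
    rw [Finset.card_singleton] at h4
    omega)
  rw [mem_nbrs] at hu
  have := hmax {v, u} (by
    intro a ha b hb hab
    simp only [Finset.mem_insert, Finset.mem_singleton] at ha hb
    rcases ha with rfl | rfl <;> rcases hb with rfl | rfl
    · exact absurd rfl hab
    · exact hu
    · exact hu.symm
    · exact absurd rfl hab)
  rwa [Finset.card_pair hu.ne] at this

theorem false_of_minCounterexample (h : MinCounterexample G d w k) : False := by
  obtain ⟨Q, hQ, hQ2, hmax⟩ := h.exists_maximum_clique
  have honly : ∀ y ∈ Q, ∀ z ∈ Q, y ≠ z → ∀ u, u ∉ Q → G.Adj y u → G.Adj z u → False := by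
    intro y hy z hz hyz u hu hyu hzu
    obtain ⟨t, ht, hut⟩ : ∃ t ∈ Q, ¬G.Adj u t := by
      by_contra! hcon
      have := hmax (insert u Q) (by
        intro a ha b hb hab
        rcases Finset.mem_insert.1 ha with rfl | ha' <;>
          rcases Finset.mem_insert.1 hb with rfl | hb'
        · exact absurd rfl hab
        · exact hcon b hb'
        · exact (hcon a ha').symm
        · exact hQ a ha' b hb' hab)
      rw [Finset.card_insert_of_notMem hu] at this
      omega
    refine h.not_isDiamond (p := y) (q := z) (a := u) (b := t)
      ⟨hQ y hy z hz hyz, hyu, hQ y hy t ht ?_, hzu, hQ z hz t ht ?_, ?_, hut⟩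
    · rintro rfl
      exact hut hyu.symm
    · rintro rfl
      exact hut hzu.symm
    · rintro rfl
      exact hu ht
  have hout : ∀ y ∈ Q, ∀ u, u ∉ Q → ∀ v, v ∉ Q → G.Adj y u → G.Adj y v → u ≠ v → G.Adj u v := by
    intro y hy u hu v hv hyu hyv huv
    obtain ⟨t, ht, hty⟩ := Finset.exists_mem_ne (by omega : 1 < Q.card) y
    rcases h.claw_free' hyu hyv (hQ y hy t ht hty.symm) huv
      (fun e => hu (e ▸ ht)) (fun e => hv (e ▸ ht)) with h1 | h1 | h1
    · exact h1
    · exact (honly y hy t ht hty.symm u hu hyu h1.symm).elim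
    · exact (honly y hy t ht hty.symm v hv hyv h1.symm).elim
  obtain ⟨x, hx, hxmax⟩ := Finset.exists_max_image Q (fun y => (nbrs G y \ Q).card)
    (Finset.card_pos.1 (by omega))
  set R : V → Finset V := fun y => nbrs G y \ Q with hR
  have memR : ∀ y u, u ∈ R y ↔ G.Adj y u ∧ u ∉ Q := by simp [hR]
  have hdeg : (Q.card - 1) + (R x).card ≤ d := by
    refine le_trans ?_ (h.card_nbrs_le x)
    rw [← Finset.card_erase_of_mem hx, ← Finset.card_union_of_disjoint]
    · refine Finset.card_le_card fun u hu => ?_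
      rcases Finset.mem_union.1 hu with hu | hu
      · exact mem_nbrs.2 (hQ x hx u (Finset.mem_of_mem_erase hu) (Finset.ne_of_mem_erase hu).symm)
      · exact mem_nbrs.2 ((memR x u).1 hu).1
    · rw [Finset.disjoint_left]
      exact fun u hu hu' => ((memR x u).1 hu').2 (Finset.mem_of_mem_erase hu)
  have hRx : (R x).card + 1 ≤ Q.card := by
    rw [← Finset.card_insert_of_notMem (s := R x) (a := x) (fun hh => ((memR x x).1 hh).2 hx)]
    refine hmax _ fun a ha b hb hab => ?_
    simp only [Finset.mem_insert, memR] at ha hb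
    rcases ha with rfl | ha <;> rcases hb with rfl | hb
    · exact absurd rfl hab
    · exact hb.1
    · exact ha.1.symm
    · exact hout x hx a ha.2 b hb.2 ha.1 hb.1 hab
  have hDw := h.card_clique_le Q hQ
  have hk2 := h.bound_eq
  obtain ⟨c, hck, hc⟩ := h.exists_coloring x
  have hfree : ∀ e : V → ℕ, (∀ u, u ≠ x → e u < k) →
      (∀ u, u ≠ x → ∀ v, v ≠ x → G.Adj u v → e u ≠ e v) → ∀ i < k,
      (∀ u, G.Adj x u → e u ≠ i) → False := fun e he1 he2 i hi hxi => by
    obtain ⟨u, hu, hui⟩ := exists_adj_of_not_colorableOn h.not_colorableOn he1 he2 hi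
    exact hxi u hu hui
  set C := (Q.erase x).image c with hC
  have hCcard : C.card ≤ Q.card - 1 := by
    rw [← Finset.card_erase_of_mem hx]
    exact Finset.card_image_le
  have hCR : ∀ i < k, i ∉ C → i ∈ (R x).image c := by
    intro i hi hiC
    obtain ⟨u, hu, rfl⟩ := exists_adj_of_not_colorableOn h.not_colorableOn hck hc hi
    by_cases huQ : u ∈ Q
    · exact absurd (Finset.mem_image_of_mem c (Finset.mem_erase.2 ⟨hu.ne', huQ⟩)) hiC
    · exact Finset.mem_image_of_mem c ((memR x u).2 ⟨hu, huQ⟩)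
  have hpick : ∀ s : Finset ℕ, s.card < k → ∃ i < k, i ∉ s := fun s hs => by
    obtain ⟨i, hi, his⟩ := Finset.exists_mem_notMem_of_card_lt_card
      (s := s) (t := Finset.range k) (by simpa using hs)
    exact ⟨i, Finset.mem_range.1 hi, his⟩
  have hcQ : ∀ u ∈ Q, ∀ v ∈ Q, u ≠ x → v ≠ x → c u = c v → u = v := by
    intro u hu v hv hux hvx huv
    by_contra hne
    exact hc u hux v hvx (hQ u hu v hv hne) huv
  have himg : ∀ y, ((R y).image c).card ≤ (R y).card := fun y => Finset.card_image_le
  obtain ⟨α, hα, hαR⟩ := hpick ((R x).image c) (by have := himg x; omega)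
  have hαC : α ∈ C := by
    by_contra hcon
    exact hαR (hCR α hα hcon)
  obtain ⟨q, hq, hqα⟩ := Finset.mem_image.1 hαC
  obtain ⟨hqx, hqQ⟩ := Finset.mem_erase.1 hq
  have hαx : ∀ u, G.Adj x u → c u = α → u = q := by
    intro u hu huα
    by_cases huQ : u ∈ Q
    · exact hcQ u huQ q hqQ hu.ne' hqx (huα.trans hqα.symm)
    · exact absurd (huα ▸ Finset.mem_image_of_mem c ((memR x u).2 ⟨hu, huQ⟩)) hαR
  -- The vertex `q` can be recoloured in no way, since that would free `α` at `x`.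
  have hrecolor : ∀ e : V → ℕ, (∀ u, u ≠ x → e u < k) →
      (∀ u, u ≠ x → ∀ v, v ≠ x → G.Adj u v → e u ≠ e v) → (∀ u, e u = α → c u = α) → ∀ i < k,
      i ≠ α → (∀ u, u ≠ x → G.Adj q u → e u ≠ i) → False := by
    intro e he1 he2 heα i hi hiα hqi
    refine hfree (Function.update e q i) (fun u hu => ?_) (fun u hu v hv huv => ?_) α hα
      fun u hu huα => ?_
    · by_cases huq : u = q
      · simpa [huq] using hi
      · simpa [huq] using he1 u hu
    · by_cases huq : u = q <;> by_cases hvq : v = q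
      · exact absurd huv (by simp [huq, hvq])
      · subst huq
        simpa [hvq] using (hqi v hv huv).symm
      · subst hvq
        simpa [huq] using hqi u hu huv.symm
      · simpa [huq, hvq] using he2 u hu v hv huv
    · by_cases huq : u = q
      · exact hiα (by simpa [huq] using huα)
      · rw [Function.update_of_ne huq] at huα
        exact huq (hαx u hu (heα u huα))
  have hCRq : ∀ i < k, i ∉ C → i ∈ (R q).image c := by
    intro i hi hiC
    by_contra hcon
    refine hrecolor c hck hc (fun u hu => hu) i hi (fun e => hiC (e ▸ hαC)) fun u hu hqu hui => ?_
    by_cases huQ : u ∈ Q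
    · exact hiC (hui ▸ Finset.mem_image_of_mem c (Finset.mem_erase.2 ⟨hu, huQ⟩))
    · exact hcon (hui ▸ Finset.mem_image_of_mem c ((memR q u).2 ⟨hqu, huQ⟩))
  obtain ⟨γ, hγ, hγ'⟩ := hpick (insert α ((R x).image c ∪ (R q).image c)) (by
    have h1 := Finset.card_insert_le α ((R x).image c ∪ (R q).image c)
    have h2 := Finset.card_union_add_card_inter ((R x).image c) ((R q).image c)
    have h3 : (Finset.range k \ C).card ≤ ((R x).image c ∩ (R q).image c).card := by
      refine Finset.card_le_card fun i hi => ?_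
      obtain ⟨hi1, hi2⟩ := Finset.mem_sdiff.1 hi
      rw [Finset.mem_range] at hi1
      exact Finset.mem_inter.2 ⟨hCR i hi1 hi2, hCRq i hi1 hi2⟩
    have h4 := Finset.le_card_sdiff C (Finset.range k)
    rw [Finset.card_range] at h4
    have h5 := himg x
    have h6 := himg q
    have h7 : (R q).card ≤ (R x).card := hxmax q hqQ
    omega)
  simp only [Finset.mem_insert, Finset.mem_union, not_or] at hγ'
  obtain ⟨hγα, hγx, hγq⟩ := hγ'
  have hγC : γ ∈ C := by
    by_contra hcon
    exact hγx (hCR γ hγ hcon)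
  obtain ⟨p, hp, hpγ⟩ := Finset.mem_image.1 hγC
  obtain ⟨hpx, hpQ⟩ := Finset.mem_erase.1 hp
  have hpq : p ≠ q := by
    rintro rfl
    exact hγα (hpγ.symm.trans hqα)
  obtain ⟨β, hβ, hβC⟩ := hpick C (by omega)
  obtain ⟨r, hr, hrβ⟩ := Finset.mem_image.1 (hCR β hβ hβC)
  obtain ⟨s, hs, hsβ⟩ := Finset.mem_image.1 (hCRq β hβ hβC)
  obtain ⟨hxr, hrQ⟩ := (memR _ _).1 hr
  obtain ⟨hqs, hsQ⟩ := (memR _ _).1 hs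
  have hβγ : β ≠ γ := fun e => hβC (e ▸ hγC)
  have hβα : β ≠ α := fun e => hβC (e ▸ hαC)
  have hβQ : ∀ u ∈ Q, u ≠ x → c u ≠ β := fun u hu hux e =>
    hβC (e ▸ Finset.mem_image_of_mem c (Finset.mem_erase.2 ⟨hux, hu⟩))
  have hγadj : ∀ y, y = x ∨ y = q → ∀ u, u ≠ x → G.Adj y u → c u = γ → u = p := by
    intro y hy u hux hu huγ
    by_cases huQ : u ∈ Q
    · exact hcQ u huQ p hpQ hux hpx (huγ.trans hpγ.symm)
    · have := huγ ▸ Finset.mem_image_of_mem c ((memR y u).2 ⟨hu, huQ⟩)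
      rcases hy with rfl | rfl
      · exact absurd this hγx
      · exact absurd this hγq
  have hrs : r ≠ s := by
    rintro rfl
    exact honly x hx q hqQ hqx.symm r hrQ hxr hqs
  have hsx : s ≠ x := fun e => hsQ (e ▸ hx)
  set B := bicoloured G x c β γ with hB
  have hBβ : ∀ u a, c u = β → B.Adj u a → c a = γ ∧ a ≠ x ∧ G.Adj u a := fun u a hu ha =>
    ⟨by have := ha.2.2.2; omega, ha.2.2.1, ha.1⟩
  have hdr : (nbrs B r).card ≤ 1 := by
    refine h.card_bicoloured_le_one hc hxr.symm fun a ha => ?_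
    obtain ⟨h1, h2, h3⟩ := hBβ r a hrβ ha
    refine ⟨h2, fun h4 => ?_⟩
    obtain rfl := hγadj x (.inl rfl) a h2 h4.symm h1
    exact honly x hx a hpQ hpx.symm r hrQ hxr h3.symm
  have hds : (nbrs B s).card ≤ 1 := by
    refine h.card_bicoloured_le_one hc hqs.symm fun a ha => ?_
    obtain ⟨h1, h2, h3⟩ := hBβ s a hsβ ha
    refine ⟨fun e => hγα (by rw [← h1, e, hqα]), fun h4 => ?_⟩
    obtain rfl := hγadj q (.inr rfl) a h2 h4.symm h1
    exact honly q hqQ a hpQ hpq.symm s hsQ hqs h3.symm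
  have hdp : (nbrs B p).card ≤ 1 := by
    refine h.card_bicoloured_le_one hc (hQ p hpQ x hx hpx) fun a ha => ?_
    have h1 : c a = β := by have := ha.2.2.2; omega
    refine ⟨ha.2.2.1, fun h4 => ?_⟩
    by_cases haQ : a ∈ Q
    · exact hβQ a haQ ha.2.2.1 h1
    · exact honly p hpQ x hx hpx a haQ ha.1 h4.symm
  have hnot : ¬(B.Reachable p r ∧ B.Reachable p s) := by
    rintro ⟨h1, h2⟩
    obtain ⟨O, hO⟩ : ∃ O : Finset V, ∀ u, u ∈ O ↔ B.Reachable p u :=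
      ⟨Finset.univ.filter fun u => B.Reachable p u, by simp⟩
    have hsum := two_mul_card_reachable_le hO
    have hT : ({p, r, s} : Finset V) ⊆ O := by
      simp [Finset.insert_subset_iff, hO, h1, h2]
    have hTc : ({p, r, s} : Finset V).card = 3 := Finset.card_eq_three.2
      ⟨p, r, s, fun e => hrQ (e ▸ hpQ), fun e => hsQ (e ▸ hpQ), hrs, rfl⟩
    have h3 : ∑ u ∈ {p, r, s}, (nbrs B u).card ≤ ({p, r, s} : Finset V).card • 1 :=
      Finset.sum_le_card_nsmul _ _ _ (by simp [hdp, hdr, hds])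
    have h4 : ∑ u ∈ O \ {p, r, s}, (nbrs B u).card ≤ (O \ {p, r, s}).card • 2 :=
      Finset.sum_le_card_nsmul _ _ _ fun u _ => h.card_bicoloured_le_two hc u
    have h5 := Finset.sum_sdiff (f := fun u => (nbrs B u).card) hT
    have h6 := Finset.card_sdiff_add_card_eq_card hT
    simp only [smul_eq_mul] at h3 h4
    omega
  have hβadj : ∀ y ∈ Q, ∀ z, z ∉ Q → G.Adj y z → c z = β → ∀ u, u ≠ x → G.Adj y u → c u = β →
      u = z := by
    intro y hy z hz hyz hzβ u hux hyu huβ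
    by_contra hne
    have huQ : u ∉ Q := fun hu => hβQ u hu hux huβ
    exact hc u hux z (fun e => hz (e ▸ hx)) (hout y hy u huQ z hz hyu hyz hne) (huβ.trans hzβ.symm)
  have hkey : ∀ y ∈ Q, (y = x ∨ y = q) → ∀ z, z ∉ Q → G.Adj y z → c z = β → ¬B.Reachable p z →
      ∀ u, u ≠ x → G.Adj y u → kempe G x c β γ p u ≠ γ := by
    intro y hyQ hy z hz hyz hzβ hpz u hux hyu huγ
    rcases kempe_eq_right huγ with ⟨h1, h2⟩ | ⟨h1, h2⟩
    · exact hpz (hβadj y hyQ z hz hyz hzβ u hux hyu h2 ▸ h1)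
    · exact h1 (hγadj y hy u hux hyu h2 ▸ Reachable.refl _)
  have hk1 : ∀ u, u ≠ x → kempe G x c β γ p u < k := fun u hu => kempe_lt hβ hγ hck hu
  have hk2 : ∀ u, u ≠ x → ∀ v, v ≠ x → G.Adj u v →
      kempe G x c β γ p u ≠ kempe G x c β γ p v := fun u hu v hv huv => kempe_ne hc hu hv huv
  by_cases hpr : B.Reachable p r
  · exact hrecolor _ hk1 hk2 (fun u hu => eq_of_kempe_eq hβα.symm (Ne.symm hγα) hu) γ hγ hγα
      (hkey q hqQ (.inr rfl) s hsQ hqs hsβ fun hps => hnot ⟨hpr, hps⟩)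
  · exact hfree _ hk1 hk2 γ hγ fun u hu =>
      hkey x hx (.inl rfl) r hrQ hxr hrβ hpr u hu.ne' hu

end MinCounterexample
end

section
open scoped Classical

theorem ChairFree.comap {V W : Type*} {G : SimpleGraph V} (hG : ChairFree G) {f : W → V}
    (hf : Function.Injective f) : ChairFree (G.comap f) :=
  fun c a b x y h1 h2 h3 h4 h5 => hG (f c) (f a) (f b) (f x) (f y) h1 h2 h3 h4 (hf.ne h5)

theorem KiteFree.comap {V W : Type*} {G : SimpleGraph V} (hG : KiteFree G) (f : W → V) :
    KiteFree (G.comap f) :=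
  fun p q a b z => hG (f p) (f q) (f a) (f b) (f z)

theorem colorableOn_univ_of_chairFree_kiteFree {V : Type*} [Fintype V] {G : SimpleGraph V}
    (hC : ChairFree G) (hK : KiteFree G) {d w : ℕ} (hd : ∀ x, (nbrs G x).card ≤ d)
    (hw : ∀ s, CliqueOn G s → s.card ≤ w) : ColorableOn G Finset.univ ((d + w + 2) / 2) := by
  induction hn : Fintype.card V using Nat.strong_induction_on generalizing V d w with
  | _ n ih =>
    subst hn
    by_contra hcol
    refine MinCounterexample.false_of_minCounterexample
      (G := G) (d := d) (w := w) ⟨hC, hK, hd, hw, rfl, hcol, fun s hs d' w' hd' hw' => ?_⟩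
    have hcard : Fintype.card s < Fintype.card V := by
      rw [Fintype.card_coe]
      exact Finset.card_lt_univ_of_notMem (Classical.choose_spec
        (by simpa [Finset.eq_univ_iff_forall] using hs : ∃ x, x ∉ s))
    have := ih _ hcard (G := G.comap (Subtype.val : s → V))
      (hC.comap Subtype.val_injective) (hK.comap _) (d := d') (w := w') (fun x => ?_)
      (fun t ht => ?_) rfl
    · simpa only [map_subtype_univ] using colorableOn_comap_iff.1 this
    · rw [← Finset.card_map (Function.Embedding.subtype _)]
      refine (Finset.card_le_card fun y hy => ?_).trans (hd' x x.2)
      obtain ⟨u, hu, rfl⟩ := Finset.mem_map.1 hy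
      exact Finset.mem_inter.2 ⟨mem_nbrs.2 (comap_adj.1 (mem_nbrs.1 hu)), u.2⟩
    · rw [← Finset.card_map (Function.Embedding.subtype _)]
      refine hw' _ (fun y hy => ?_) fun y hy z hz hyz => ?_
      · obtain ⟨u, hu, rfl⟩ := Finset.mem_map.1 hy
        exact u.2
      · obtain ⟨u, hu, rfl⟩ := Finset.mem_map.1 hy
        obtain ⟨v, hv, rfl⟩ := Finset.mem_map.1 hz
        exact ht u hu v hv fun e => hyz (by rw [e])

theorem chairFree_of_isEmpty {V : Type*} {G : SimpleGraph V} (hG : IsEmpty (chair ↪g G)) :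
    ChairFree G := by
  intro c a b x y hca hcb hcx hxy hab nab nax nbx ncy nay nby
  have hay : a ≠ y := by rintro rfl; exact ncy hca
  have hby : b ≠ y := by rintro rfl; exact ncy hcb
  have hax : a ≠ x := by rintro rfl; exact nay hxy
  have hbx : b ≠ x := by rintro rfl; exact nby hxy
  have hcy : c ≠ y := by rintro rfl; exact nay hca.symm
  refine hG.elim ⟨⟨![a, c, x, y, b], fun i j => ?_⟩, fun {i j} => ?_⟩
  · fin_cases i <;> fin_cases j <;>
      simp [hca.ne, hca.ne', hcb.ne, hcb.ne', hcx.ne, hcx.ne', hxy.ne, hxy.ne', hab, hab.symm,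
        hay, hay.symm, hby, hby.symm, hax, hax.symm, hbx, hbx.symm, hcy, hcy.symm]
  · change G.Adj (![a, c, x, y, b] i) (![a, c, x, y, b] j) ↔ _
    fin_cases i <;> fin_cases j <;>
      simp [chair, hca, hca.symm, hcb, hcb.symm, hcx, hcx.symm, hxy, hxy.symm, nab, nax, nbx, ncy,
        nay, nby, mt Adj.symm nab, mt Adj.symm nax, mt Adj.symm nbx, mt Adj.symm ncy,
        mt Adj.symm nay, mt Adj.symm nby]

theorem kiteFree_of_isEmpty {V : Type*} {G : SimpleGraph V} (hG : IsEmpty (kite ↪g G)) :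
    KiteFree G := by
  intro p q a b z hpq hpa hpb hqa hqb haz nab nzp nzq nzb
  have hab : a ≠ b := by rintro rfl; exact nzb haz.symm
  have hzp : z ≠ p := by rintro rfl; exact nzq hpq
  have hzq : z ≠ q := by rintro rfl; exact nzp hpq.symm
  have hzb : z ≠ b := by rintro rfl; exact nab haz
  refine hG.elim ⟨⟨![p, q, a, b, z], fun i j => ?_⟩, fun {i j} => ?_⟩
  · fin_cases i <;> fin_cases j <;>
      simp [hpq.ne, hpq.ne', hpa.ne, hpa.ne', hpb.ne, hpb.ne', hqa.ne, hqa.ne', hqb.ne, hqb.ne',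
        haz.ne, haz.ne', hab, hab.symm, hzp, hzp.symm, hzq, hzq.symm, hzb, hzb.symm]
  · change G.Adj (![p, q, a, b, z] i) (![p, q, a, b, z] j) ↔ _
    fin_cases i <;> fin_cases j <;>
      simp [kite, hpq, hpq.symm, hpa, hpa.symm, hpb, hpb.symm, hqa, hqa.symm, hqb, hqb.symm, haz,
        haz.symm, nab, nzp, nzq, nzb, mt Adj.symm nab, mt Adj.symm nzp, mt Adj.symm nzq,
        mt Adj.symm nzb]

theorem ColorableOn.colorable {V : Type*} [Fintype V] {G : SimpleGraph V} {k : ℕ}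
    (h : ColorableOn G Finset.univ k) : G.Colorable k := by
  obtain ⟨c, h1, h2⟩ := h
  exact ⟨Coloring.mk (fun x => ⟨c x, h1 x (Finset.mem_univ x)⟩) fun {u v} huv e =>
    h2 u (Finset.mem_univ u) v (Finset.mem_univ v) huv (congrArg Fin.val e)⟩
end

/-- Reed's conjecture holds for `{Chair, Kite}`-free graphs. -/
theorem reed_chair_kite_free {V : Type*} [Fintype V] (G : SimpleGraph V)
    [DecidableRel G.Adj]
    (h1 : IsEmpty (chair ↪g G)) (h2 : IsEmpty (kite ↪g G)) :
    G.chromaticNumber ≤ (((G.maxDegree + G.cliqueNum + 1) ⌈/⌉ 2 : ℕ) : ℕ∞) := by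
  refine Colorable.chromaticNumber_le ?_
  rw [Nat.ceilDiv_eq_add_pred_div]
  refine (colorableOn_univ_of_chairFree_kiteFree (chairFree_of_isEmpty h1)
    (kiteFree_of_isEmpty h2) (fun x => ?_) fun s hs => ?_).colorable
  · refine le_trans (le_of_eq ?_) (G.degree_le_maxDegree x)
    rw [← card_neighborFinset_eq_degree]
    congr 1
    ext y
    simp
  · exact IsClique.card_le_cliqueNum (t := s) (tc := fun a ha b hb hab =>
      hs a (by simpa using ha) b (by simpa using hb) hab)
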